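/- arXiv:1801.08765 — 6 statements merged into one kernel-verified Lean document; each statement's English description precedes it below -/
import Mathlib

section
/- (Ax's theorem, differential Schanuel condition SC_D). Let F be a field of characteristic zero, let Δ be a set of derivations D : F → F, and let C = {x ∈ F : D x = 0 for all D ∈ Δ} be the common constant subfield. Let x₁,…,xₙ, y₁,…,yₙ ∈ F with each yᵢ ≠ 0 and D yᵢ = yᵢ · D xᵢ for every i and every D ∈ Δ. Define rkJac(x) to be the dimension of the F-linear subspace of Fⁿ spanned by the vectors (D x₁, …, D xₙ) as D ranges over Δ. If the transcendence degree of C(x₁, y₁, …, xₙ, yₙ) over C is strictly less than n + rkJac(x), then there exist integers m₁,…,mₙ, not all zero, such that Σᵢ mᵢ xᵢ ∈ C and Πᵢ yᵢ^{mᵢ} ∈ C. -/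
set_option maxHeartbeats 1000000
set_option synthInstance.maxHeartbeats 400000

/-- Transcendence degree of an algebra extension. -/
noncomputable def trdeg (F E : Type*) [CommRing F] [CommRing E] [Algebra F E] : Cardinal :=
  ⨆ s : { s : Set E // AlgebraicIndependent F ((↑) : s → E) }, Cardinal.mk s.1

/-- The common constant subfield of a set of derivations on a field of characteristic zero. -/
noncomputable def constants (F : Type*) [Field F] [CharZero F]
    (Δ : Set (Derivation ℚ F F)) : Subfield F where
  carrier := {x | ∀ D ∈ Δ, D x = 0}
  add_mem' := fun ha hb D hD => by simp [ha D hD, hb D hD]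
  mul_mem' := fun {a b} ha hb D hD => by
    simp [Derivation.leibniz, ha D hD, hb D hD]
  neg_mem' := fun ha D hD => by simp [ha D hD]
  one_mem' := fun D _ => D.map_one_eq_zero
  zero_mem' := fun D _ => D.map_zero
  inv_mem' := fun x hx D hD => by
    rw [Derivation.leibniz_inv]
    simp [hx D hD]

open Polynomial

theorem mem_constants {F : Type*} [Field F] [CharZero F] {Δ : Set (Derivation ℚ F F)} {z : F} :
    z ∈ constants F Δ ↔ ∀ D ∈ Δ, D z = 0 := Iff.rfl

/-- In characteristic zero the field of constants is relatively algebraically closed. -/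
theorem mem_constants_of_isAlgebraic {F : Type*} [Field F] [CharZero F]
    {Δ : Set (Derivation ℚ F F)} {z : F} (hz : IsAlgebraic (constants F Δ) z) :
    z ∈ constants F Δ := by
  intro D hD
  let D' : Derivation (constants F Δ) F F := Derivation.mk'
    { toFun := D
      map_add' := map_add D
      map_smul' := fun c a => by
        have hc : D (c : F) = 0 := c.2 D hD
        simp [Subfield.smul_def, Derivation.leibniz, hc] } (fun a b => D.leibniz a b)
  have h := D'.map_aeval (minpoly (constants F Δ) z) z
  rw [minpoly.aeval, map_zero, eq_comm, smul_eq_mul, mul_eq_zero] at h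
  refine h.resolve_left ?_
  have hsep : (minpoly (constants F Δ) z).Separable :=
    (minpoly.irreducible hz.isIntegral).separable
  exact hsep.aeval_derivative_ne_zero (minpoly.aeval _ _)

/-- A derivation trivial on a subfield is trivial on everything algebraic over that subfield. -/
theorem Derivation.eq_zero_of_isAlgebraic {F : Type*} [Field F] [CharZero F]
    (D : Derivation ℚ F F) {K : Type*} [Field K] [Algebra K F]
    (hK : ∀ a : K, D (algebraMap K F a) = 0) {z : F} (hz : IsAlgebraic K z) : D z = 0 := by
  let f : K →+* constants F {D} := (algebraMap K F).codRestrict _ fun a D' hD' => by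
    rw [Set.mem_singleton_iff.1 hD']; exact hK a
  have hz' : IsAlgebraic (constants F {D}) z := by
    obtain ⟨p, hp, hpz⟩ := hz
    refine ⟨p.map f, (Polynomial.map_ne_zero_iff f.injective).2 hp, ?_⟩
    rw [aeval_def, eval₂_map]
    exact hpz
  exact mem_constants_of_isAlgebraic hz' D rfl

/-- A nonzero subspace of `Fⁿ` stable under a set of derivations contains a nonzero vector of
constants. -/
theorem exists_constant_vector {F : Type*} [Field F] [CharZero F] {Δ : Set (Derivation ℚ F F)}
    {n : ℕ} (U : Submodule F (Fin n → F)) (hU : U ≠ ⊥)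
    (hstab : ∀ D ∈ Δ, ∀ c ∈ U, (fun i => D (c i)) ∈ U) :
    ∃ c ∈ U, c ≠ 0 ∧ ∀ i, c i ∈ constants F Δ := by
  classical
  have key : ∀ k : ℕ, ∀ c ∈ U, c ≠ 0 → (Finset.univ.filter fun i => c i ≠ 0).card = k →
      ∃ c ∈ U, c ≠ 0 ∧ ∀ i, c i ∈ constants F Δ := by
    intro k
    induction k using Nat.strong_induction_on with
    | _ k ih =>
      intro c hc hc0 hk
      obtain ⟨i₀, hi₀⟩ := Function.ne_iff.1 hc0
      have hb : (c i₀)⁻¹ • c ∈ U := U.smul_mem _ hc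
      set b := (c i₀)⁻¹ • c with hbdef
      have hbi : b i₀ = 1 := by simpa [hbdef] using inv_mul_cancel₀ hi₀
      have hb0 : ∀ i, c i = 0 → b i = 0 := fun i hi => by simp [hbdef, hi]
      by_cases hconst : ∀ i, b i ∈ constants F Δ
      · exact ⟨b, hb, Function.ne_iff.2 ⟨i₀, by simp [hbi]⟩, hconst⟩
      · simp only [mem_constants, not_forall] at hconst
        obtain ⟨j, D, hD, hj⟩ := hconst
        refine ih _ ?_ _ (hstab D hD b hb) (Function.ne_iff.2 ⟨j, hj⟩) rfl
        rw [← hk]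
        refine Finset.card_lt_card ((Finset.ssubset_iff_of_subset fun i hi => ?_).2
          ⟨i₀, by simpa using hi₀, by simp [hbi]⟩)
        simp only [Finset.mem_filter, Finset.mem_univ, true_and] at hi ⊢
        exact fun h => hi (by simp [hb0 i h])
  obtain ⟨c, hc, hc0⟩ := U.ne_bot_iff.1 hU
  exact key _ c hc hc0 rfl

/-- A dimension count: if `ρ` controls `u` and `ω`, and `ω` vanishes on a subspace with large
image under `u`, then `ω` is not surjective. -/
theorem not_surjective_of_finrank_lt {F V W W₁ W₂ : Type*} [Field F] [AddCommGroup V] [Module F V]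
    [AddCommGroup W] [Module F W] [Module.Finite F W]
    [AddCommGroup W₁] [Module F W₁] [AddCommGroup W₂] [Module F W₂]
    (ρ : V →ₗ[F] W) (u : V →ₗ[F] W₁) (ω : V →ₗ[F] W₂)
    (hu : LinearMap.ker ρ ≤ LinearMap.ker u) (hω : LinearMap.ker ρ ≤ LinearMap.ker ω)
    (A : Submodule F V) (hA : A ≤ LinearMap.ker ω)
    (hlt : Module.finrank F W < Module.finrank F W₂ + Module.finrank F (A.map u)) :
    ¬ Function.Surjective ω := by
  intro hsurj
  let N := LinearMap.ker ρ
  let u' := N.liftQ u hu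
  let ω' := N.liftQ ω hω
  let e := ρ.quotKerEquivRange
  have hfin : Module.Finite F (V ⧸ N) := Module.Finite.equiv e.symm
  have h1 : Module.finrank F (V ⧸ N) ≤ Module.finrank F W := by
    rw [e.finrank_eq]; exact Submodule.finrank_le _
  have h2 := LinearMap.finrank_range_add_finrank_ker ω'
  have hsurj' : LinearMap.range ω' = ⊤ := by
    rw [Submodule.range_liftQ]; exact LinearMap.range_eq_top.2 hsurj
  rw [hsurj', finrank_top] at h2
  have h3 : A.map u ≤ (LinearMap.ker ω').map u' := by
    rintro _ ⟨a, ha, rfl⟩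
    exact ⟨N.mkQ a, by simpa [ω'] using hA ha, by simp [u']⟩
  have h4 : Module.finrank F (A.map u) ≤ Module.finrank F (LinearMap.ker ω') :=
    (Submodule.finrank_mono h3).trans (Submodule.finrank_map_le _ _)
  omega

/-- A finite set of elements, no larger than the transcendence degree, over which the given set
of generators is algebraic. -/
theorem exists_finite_algebraic_basis {F : Type*} [Field F] (C : Subfield F) (S : Set F) (N : ℕ)
    (h : trdeg C (IntermediateField.adjoin C S) < (N : Cardinal)) :
    ∃ s : Set F, s.Finite ∧ s.ncard < N ∧ ∀ z ∈ S, IsAlgebraic (IntermediateField.adjoin C s) z := by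
  let K := IntermediateField.adjoin C S
  obtain ⟨b, hb⟩ := exists_isTranscendenceBasis C K
  have hle : Cardinal.mk b ≤ trdeg C K :=
    le_ciSup (f := fun s : {s : Set K // AlgebraicIndependent C ((↑) : s → K)} => Cardinal.mk s.1)
      Cardinal.bddAbove_of_small ⟨b, hb.1⟩
  have hlt : Cardinal.mk b < (N : Cardinal) := hle.trans_lt h
  have hfin : b.Finite := Cardinal.lt_aleph0_iff_set_finite.1 (hlt.trans Cardinal.natCast_lt_aleph0)
  have hcard : b.ncard < N := by
    rw [← Set.cast_ncard hfin] at hlt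
    exact_mod_cast hlt
  refine ⟨(↑) '' b, hfin.image _, (Set.ncard_image_le hfin).trans_lt hcard, fun z hz => ?_⟩
  have halg := hb.isAlgebraic_field
  rw [Subtype.range_coe] at halg
  let z' : K := ⟨z, IntermediateField.subset_adjoin C S hz⟩
  obtain ⟨p, hp, hpz⟩ := halg.isAlgebraic z'
  have hmap : ∀ a ∈ IntermediateField.adjoin C b,
      (a : F) ∈ IntermediateField.adjoin C ((↑) '' b : Set F) := by
    intro a ha
    have := IntermediateField.adjoin_map C b K.val
    have h2 : K.val a ∈ (IntermediateField.adjoin C b).map K.val := ⟨a, ha, rfl⟩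
    rw [this] at h2
    exact h2
  let f : IntermediateField.adjoin C b →+* IntermediateField.adjoin C ((↑) '' b : Set F) :=
    ((algebraMap K F).comp (algebraMap (IntermediateField.adjoin C b) K)).codRestrict _
      fun a => hmap a a.2
  refine ⟨p.map f, (Polynomial.map_ne_zero_iff f.injective).2 hp, ?_⟩
  have h3 := congrArg (algebraMap K F) hpz
  rw [map_zero, aeval_def, hom_eval₂] at h3
  rw [aeval_def, eval₂_map]
  exact h3

/-- The transcendence degree bound forces a linear relation with constant coefficients between
the functionals `δ ↦ δ (y i) / y i - δ (x i)`. -/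
theorem exists_constant_relation {F : Type*} [Field F] [CharZero F] (Δ : Set (Derivation ℚ F F))
    (n : ℕ) (x y : Fin n → F) (hy : ∀ i, y i ≠ 0)
    (hexp : ∀ D ∈ Δ, ∀ i, D (y i) = y i * D (x i))
    (htd : trdeg (constants F Δ)
        (IntermediateField.adjoin (constants F Δ) (Set.range x ∪ Set.range y))
      < (n : Cardinal) + Module.rank F
          (Submodule.span F {v : Fin n → F | ∃ D ∈ Δ, v = fun i => D (x i)})) :
    ∃ c : Fin n → F, c ≠ 0 ∧ (∀ i, c i ∈ constants F Δ) ∧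
      ∀ δ : Derivation ℚ F F, (∀ a ∈ constants F Δ, δ a = 0) →
        ∑ i, c i * (δ (y i) / y i - δ (x i)) = 0 := by
  classical
  rw [← Module.finrank_eq_rank, ← Nat.cast_add] at htd
  obtain ⟨s, hs, hscard, hsalg⟩ := exists_finite_algebraic_basis _ _ _ htd
  let T : Submodule F (Derivation ℚ F F) :=
    { carrier := {δ | ∀ a ∈ constants F Δ, δ a = 0}
      add_mem' := fun h₁ h₂ a ha => by simp [h₁ a ha, h₂ a ha]
      zero_mem' := fun a _ => by simp
      smul_mem' := fun b δ h a ha => by simp [h a ha] }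
  have hΔT : ∀ D ∈ Δ, D ∈ T := fun D hD a ha => ha D hD
  let ρ : T →ₗ[F] (s → F) :=
    { toFun := fun δ z => δ.1 z
      map_add' := fun _ _ => rfl
      map_smul' := fun _ _ => rfl }
  let u : T →ₗ[F] (Fin n → F) :=
    { toFun := fun δ i => δ.1 (x i)
      map_add' := fun _ _ => rfl
      map_smul' := fun _ _ => rfl }
  let ω : T →ₗ[F] (Fin n → F) :=
    { toFun := fun δ i => δ.1 (y i) / y i - δ.1 (x i)
      map_add' := fun δ₁ δ₂ => by ext i; simp; ring
      map_smul' := fun a δ => by ext i; simp; ring }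
  have hker : ∀ δ ∈ LinearMap.ker ρ, ∀ z ∈ Set.range x ∪ Set.range y, δ.1 z = 0 := by
    intro δ hδ z hz
    have hle : ∀ a ∈ IntermediateField.adjoin (constants F Δ) s, δ.1 a = 0 := by
      intro a ha
      induction ha using IntermediateField.adjoin_induction with
      | mem a ha => exact congrFun (LinearMap.mem_ker.1 hδ) ⟨a, ha⟩
      | algebraMap a => exact δ.2 _ a.2
      | add a b _ _ h₁ h₂ => simp [h₁, h₂]
      | mul a b _ _ h₁ h₂ => simp [h₁, h₂]
      | inv a _ h => simp [Derivation.leibniz_inv, h]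
    exact Derivation.eq_zero_of_isAlgebraic δ.1
      (K := IntermediateField.adjoin (constants F Δ) s) (fun a => hle _ a.2) (hsalg z hz)
  have hku : LinearMap.ker ρ ≤ LinearMap.ker u := fun δ hδ =>
    LinearMap.mem_ker.2 (funext fun i => hker δ hδ _ (Or.inl ⟨i, rfl⟩))
  have hkω : LinearMap.ker ρ ≤ LinearMap.ker ω := fun δ hδ =>
    LinearMap.mem_ker.2 (funext fun i => by
      simp [ω, hker δ hδ _ (Or.inl ⟨i, rfl⟩), hker δ hδ _ (Or.inr ⟨i, rfl⟩)])
  let A : Submodule F T := Submodule.span F {δ | δ.1 ∈ Δ}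
  have hA : A ≤ LinearMap.ker ω := by
    refine Submodule.span_le.2 fun δ hδ => LinearMap.mem_ker.2 (funext fun i => ?_)
    simp [ω, hexp δ.1 hδ i, hy i]
  have hAu : A.map u = Submodule.span F {v : Fin n → F | ∃ D ∈ Δ, v = fun i => D (x i)} := by
    rw [Submodule.map_span]
    congr 1
    ext v
    constructor
    · rintro ⟨δ, hδ, rfl⟩
      exact ⟨δ.1, hδ, rfl⟩
    · rintro ⟨D, hD, rfl⟩
      exact ⟨⟨D, hΔT D hD⟩, hD, rfl⟩
  have : Fintype s := hs.fintype
  have hnsurj : ¬ Function.Surjective ω := by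
    refine not_surjective_of_finrank_lt ρ u ω hku hkω A hA ?_
    rw [hAu, Module.finrank_fintype_fun_eq_card, Module.finrank_fintype_fun_eq_card,
      Fintype.card_fin]
    rwa [Set.ncard_eq_toFinset_card' s, Set.toFinset_card] at hscard
  let U : Submodule F (Fin n → F) :=
    { carrier := {c | ∀ δ ∈ T, ∑ i, c i * (δ (y i) / y i - δ (x i)) = 0}
      add_mem' := fun h₁ h₂ δ hδ => by
        simp only [Pi.add_apply, add_mul, Finset.sum_add_distrib, h₁ δ hδ, h₂ δ hδ, add_zero]
      zero_mem' := fun δ hδ => by simp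
      smul_mem' := fun b c h δ hδ => by
        simp only [Pi.smul_apply, smul_eq_mul, mul_assoc, ← Finset.mul_sum, h δ hδ, mul_zero] }
  have hU : U ≠ ⊥ := by
    obtain ⟨f, hf0, hf⟩ := Submodule.exists_le_ker_of_lt_top (LinearMap.range ω)
      (lt_top_iff_ne_top.2 fun h => hnsurj (LinearMap.range_eq_top.1 h))
    have hfsum : ∀ v : Fin n → F, f v = ∑ i, f (Pi.single i 1) * v i := by
      intro v
      rw [LinearMap.pi_apply_eq_sum_univ f v]
      refine Finset.sum_congr rfl fun i _ => ?_
      rw [smul_eq_mul, mul_comm]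
      congr 2
      ext j
      simp [Pi.single_apply, eq_comm]
    refine U.ne_bot_iff.2 ⟨fun i => f (Pi.single i 1), fun δ hδ => ?_, fun h0 => hf0 ?_⟩
    · have := hf ⟨⟨δ, hδ⟩, rfl⟩
      rw [LinearMap.mem_ker, hfsum] at this
      exact this
    · ext i
      simpa using congrFun h0 i
  have hstab : ∀ D ∈ Δ, ∀ c ∈ U, (fun i => D (c i)) ∈ U := by
    intro D hD c hc δ hδ
    have h1 := congrArg D (hc δ hδ)
    have hbr : ⁅D, δ⁆ ∈ T := fun a ha => by
      rw [Derivation.commutator_apply, hδ a ha, ha D hD, map_zero, map_zero, sub_zero]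
    have h2 := hc _ hbr
    rw [map_sum, map_zero] at h1
    refine Eq.trans ?_ ((congrArg₂ (· - ·) h1 h2).trans (sub_zero 0))
    dsimp only
    rw [← Finset.sum_sub_distrib]
    refine Finset.sum_congr rfl fun i _ => ?_
    have hyi := hy i
    simp only [Derivation.commutator_apply, Derivation.leibniz, Derivation.leibniz_div, map_sub,
      smul_eq_mul, hexp D hD i]
    field_simp
    ring
  obtain ⟨c, hc, hc0, hcC⟩ := exists_constant_vector U hU hstab
  exact ⟨c, hc0, hcC, fun δ hδ => hc δ hδ⟩

section RationalFunctions

variable {L : Type*} [Field L]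

/-- The rational functions without a pole at the origin. -/
def regularAtZero (L : Type*) [Field L] : Subring (RatFunc L) where
  carrier := {f | ∃ a b : L[X], b.coeff 0 ≠ 0 ∧
    f = algebraMap L[X] (RatFunc L) a / algebraMap L[X] (RatFunc L) b}
  mul_mem' := by
    rintro _ _ ⟨a, b, hb, rfl⟩ ⟨a', b', hb', rfl⟩
    refine ⟨a * a', b * b', ?_, ?_⟩
    · rw [mul_coeff_zero]; exact mul_ne_zero hb hb'
    · rw [map_mul, map_mul, div_mul_div_comm]
  one_mem' := ⟨1, 1, by simp, by simp⟩
  add_mem' := by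
    rintro _ _ ⟨a, b, hb, rfl⟩ ⟨a', b', hb', rfl⟩
    refine ⟨a * b' + b * a', b * b', ?_, ?_⟩
    · rw [mul_coeff_zero]; exact mul_ne_zero hb hb'
    · have h : algebraMap L[X] (RatFunc L) b ≠ 0 :=
        RatFunc.algebraMap_ne_zero (fun h => hb (by simp [h]))
      have h' : algebraMap L[X] (RatFunc L) b' ≠ 0 :=
        RatFunc.algebraMap_ne_zero (fun h => hb' (by simp [h]))
      rw [div_add_div _ _ h h']
      simp
  zero_mem' := ⟨0, 1, by simp, by simp⟩
  neg_mem' := by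
    rintro _ ⟨a, b, hb, rfl⟩
    exact ⟨-a, b, hb, by rw [map_neg, neg_div]⟩

theorem RatFunc.algebraMap_ne_zero_of_coeff_zero {a : L[X]} (ha : a.coeff 0 ≠ 0) :
    algebraMap L[X] (RatFunc L) a ≠ 0 :=
  RatFunc.algebraMap_ne_zero fun h => ha (by simp [h])

theorem algebraMap_mem_regularAtZero (a : L[X]) :
    algebraMap L[X] (RatFunc L) a ∈ regularAtZero L :=
  ⟨a, 1, by simp, by simp⟩

/-- A regular function multiplied by `X` is never a unit at the origin. -/
theorem div_ne_X_mul_of_mem_regularAtZero {u v : L[X]} (hu : u.coeff 0 ≠ 0) (hv : v.coeff 0 ≠ 0)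
    {r : RatFunc L} (hr : r ∈ regularAtZero L) :
    algebraMap L[X] (RatFunc L) u / algebraMap L[X] (RatFunc L) v ≠ RatFunc.X * r := by
  obtain ⟨a, b, hb, rfl⟩ := hr
  intro h
  rw [← RatFunc.algebraMap_X, mul_div_assoc', div_eq_div_iff
    (RatFunc.algebraMap_ne_zero_of_coeff_zero hv) (RatFunc.algebraMap_ne_zero_of_coeff_zero hb),
    ← map_mul, ← map_mul, ← map_mul] at h
  have h2 := congrArg (fun p => p.coeff 0) (RatFunc.algebraMap_injective L h)
  simp only [mul_coeff_zero, coeff_X_zero, zero_mul] at h2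
  exact mul_ne_zero hu hb h2

theorem Polynomial.exists_eq_X_pow_mul {p : L[X]} (hp : p ≠ 0) :
    ∃ (k : ℕ) (q : L[X]), q.coeff 0 ≠ 0 ∧ p = X ^ k * q := by
  obtain ⟨q, hq, hdvd⟩ := exists_eq_pow_rootMultiplicity_mul_and_not_dvd p hp 0
  rw [C_0, sub_zero] at hq hdvd
  exact ⟨_, q, fun h => hdvd (X_dvd_iff.2 h), hq⟩

theorem RatFunc.exists_eq_X_zpow_mul {f : RatFunc L} (hf : f ≠ 0) :
    ∃ (k : ℤ) (u v : L[X]), u.coeff 0 ≠ 0 ∧ v.coeff 0 ≠ 0 ∧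
      f = RatFunc.X ^ k * (algebraMap L[X] (RatFunc L) u / algebraMap L[X] (RatFunc L) v) := by
  obtain ⟨k, u, hu, hk⟩ := Polynomial.exists_eq_X_pow_mul (RatFunc.num_ne_zero hf)
  obtain ⟨l, v, hv, hl⟩ := Polynomial.exists_eq_X_pow_mul f.denom_ne_zero
  refine ⟨k - l, u, v, hu, hv, ?_⟩
  conv_lhs => rw [← RatFunc.num_div_denom f, hk, hl]
  have := RatFunc.algebraMap_ne_zero_of_coeff_zero hv
  have hX : (RatFunc.X : RatFunc L) ≠ 0 := RatFunc.X_ne_zero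
  simp only [map_mul, map_pow, RatFunc.algebraMap_X, zpow_sub₀ hX, zpow_natCast]
  field_simp

variable [CharZero L] (δ : Derivation ℚ (RatFunc L) (RatFunc L))
  (hδ : ∀ p : L[X], δ (algebraMap L[X] (RatFunc L) p) =
    algebraMap L[X] (RatFunc L) (derivative p))

include hδ in
theorem derivation_mem_regularAtZero {f : RatFunc L} (hf : f ∈ regularAtZero L) :
    δ f ∈ regularAtZero L := by
  obtain ⟨a, b, hb, rfl⟩ := hf
  refine ⟨b * derivative a - a * derivative b, b ^ 2, ?_, ?_⟩
  · simpa [pow_two, mul_coeff_zero] using hb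
  · rw [Derivation.leibniz_div, hδ, hδ]
    simp only [smul_eq_mul, map_sub, map_mul, map_pow]
    field_simp

include hδ in
theorem derivation_X_zpow_mul (k : ℤ) (w : RatFunc L) :
    RatFunc.X * δ (RatFunc.X ^ k * w) = RatFunc.X ^ k * ((k : RatFunc L) * w + RatFunc.X * δ w) := by
  have hX : (RatFunc.X : RatFunc L) ≠ 0 := RatFunc.X_ne_zero
  have h1 : δ RatFunc.X = 1 := by
    rw [← RatFunc.algebraMap_X, hδ, derivative_X, map_one]
  rw [Derivation.leibniz, Derivation.leibniz_zpow, h1]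
  simp only [smul_eq_mul, zsmul_eq_mul, zpow_sub_one₀ hX]
  field_simp
  ring

include hδ in
/-- If a combination of logarithmic derivatives with `ℤ`-linearly independent constant
coefficients is the derivative of a rational function, then none of the functions involved
is a positive power of `X`. -/
theorem RatFunc.ne_X_pow_of_sum_logDeriv_eq {ι : Type*} [Fintype ι] (e : ι → L)
    (he : LinearIndependent ℤ e) (P : ι → RatFunc L) (hP : ∀ j, P j ≠ 0) (Q : RatFunc L)
    (h : ∑ j, RatFunc.C (e j) * (δ (P j) / P j) = δ Q) (j : ι) {N : ℕ} (hN : N ≠ 0) :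
    P j ≠ RatFunc.X ^ N := by
  have hX : (RatFunc.X : RatFunc L) ≠ 0 := RatFunc.X_ne_zero
  choose k u v hu hv hPk using fun j => RatFunc.exists_eq_X_zpow_mul (hP j)
  have hlog : ∀ j, ∃ r ∈ regularAtZero L, RatFunc.X * (δ (P j) / P j) =
      (k j : RatFunc L) + RatFunc.X * r := by
    intro j
    have hu' := RatFunc.algebraMap_ne_zero_of_coeff_zero (hu j)
    have hv' := RatFunc.algebraMap_ne_zero_of_coeff_zero (hv j)
    set w := algebraMap L[X] (RatFunc L) (u j) / algebraMap L[X] (RatFunc L) (v j) with hw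
    have hw0 : w ≠ 0 := div_ne_zero hu' hv'
    refine ⟨δ w * w⁻¹, mul_mem (derivation_mem_regularAtZero δ hδ ⟨_, _, hv j, rfl⟩)
      ⟨v j, u j, hu j, by rw [hw, inv_div]⟩, ?_⟩
    rw [← mul_div_assoc, hPk j, ← hw, derivation_X_zpow_mul δ hδ]
    clear_value w
    have := zpow_ne_zero (k j) hX
    field_simp
  choose r hr hlog using hlog
  set S : L := ∑ j, k j • e j with hS
  set R : RatFunc L := ∑ j, RatFunc.C (e j) * r j with hR
  have hRmem : R ∈ regularAtZero L := sum_mem fun j _ =>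
    mul_mem (by rw [← RatFunc.algebraMap_C]; exact algebraMap_mem_regularAtZero _) (hr j)
  have hmain : RatFunc.X * δ Q = RatFunc.C S + RatFunc.X * R := by
    rw [← h, hS, hR, Finset.mul_sum, Finset.mul_sum, map_sum, ← Finset.sum_add_distrib]
    refine Finset.sum_congr rfl fun j _ => ?_
    rw [mul_left_comm, hlog, zsmul_eq_mul, map_mul, map_intCast]
    ring
  have hregular : ∀ Q' ∈ regularAtZero L, RatFunc.X * Q' = RatFunc.C S + RatFunc.X * R →
      S = 0 := by
    intro Q' hQ' hQS
    by_contra hS0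
    refine div_ne_X_mul_of_mem_regularAtZero (u := Polynomial.C S) (v := 1) (by simpa using hS0) (by simp)
      (sub_mem hQ' hRmem) ?_
    rw [mul_sub, hQS, map_one, div_one, RatFunc.algebraMap_C]
    ring
  have hS0 : S = 0 := by
    by_cases hQ : Q = 0
    · exact hregular 0 (zero_mem _) (by rw [← hmain, hQ, map_zero])
    obtain ⟨m, a, b, ha, hb, hQm⟩ := RatFunc.exists_eq_X_zpow_mul hQ
    have hwreg : algebraMap L[X] (RatFunc L) a / algebraMap L[X] (RatFunc L) b ∈
      regularAtZero L := ⟨a, b, hb, rfl⟩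
    have hXreg : (RatFunc.X : RatFunc L) ∈ regularAtZero L := by
      rw [← RatFunc.algebraMap_X]; exact algebraMap_mem_regularAtZero _
    rcases le_or_gt 0 m with hm | hm
    · lift m to ℕ using hm
      refine hregular _ (derivation_mem_regularAtZero δ hδ ?_) hmain
      rw [hQm, zpow_natCast]
      exact mul_mem (pow_mem hXreg _) hwreg
    · obtain ⟨l, rfl⟩ : ∃ l : ℕ, m = -(l + 1 : ℕ) := ⟨(-m - 1).toNat, by omega⟩
      exfalso
      rw [hQm, derivation_X_zpow_mul δ hδ] at hmain
      have hCS : RatFunc.C S ∈ regularAtZero L := by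
        rw [← RatFunc.algebraMap_C]; exact algebraMap_mem_regularAtZero _
      set w := algebraMap L[X] (RatFunc L) a / algebraMap L[X] (RatFunc L) b with hw
      refine div_ne_X_mul_of_mem_regularAtZero
        (u := ((-(l + 1 : ℕ) : ℤ) : L[X]) * a) (v := b) ?_ hb
        (r := RatFunc.X ^ l * (RatFunc.C S + RatFunc.X * R) - δ w)
        (sub_mem (mul_mem (pow_mem hXreg _) (add_mem hCS (mul_mem hXreg hRmem)))
          (derivation_mem_regularAtZero δ hδ hwreg)) ?_
      · rw [mul_coeff_zero, ← map_intCast (Polynomial.C : L →+* L[X]), Polynomial.coeff_C_zero]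
        refine mul_ne_zero ?_ ha
        rw [Int.cast_ne_zero]
        omega
      · rw [← hmain, map_mul, map_intCast, mul_div_assoc, ← hw, mul_sub, ← mul_assoc, ← pow_succ',
          ← mul_assoc, ← zpow_natCast, ← zpow_add₀ hX, add_neg_cancel, zpow_zero]
        ring
  have hk0 : ∀ j, k j = 0 := Fintype.linearIndependent_iff.1 he k hS0
  intro hPN
  obtain ⟨N, rfl⟩ := Nat.exists_eq_succ_of_ne_zero hN
  have h2 := hPk j
  rw [hk0 j, zpow_zero, one_mul, hPN, pow_succ'] at h2
  exact div_ne_X_mul_of_mem_regularAtZero (hu j) (hv j)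
    (pow_mem (by rw [← RatFunc.algebraMap_X]; exact algebraMap_mem_regularAtZero _) N) h2.symm

end RationalFunctions

/-- A derivation into a formally étale algebra extends to that algebra. -/
theorem Derivation.exists_extension {A B : Type*} [CommRing A] [CommRing B] [Algebra ℚ A]
    [Algebra ℚ B] [Algebra A B] [IsScalarTower ℚ A B] [Algebra.FormallyEtale A B]
    (d : Derivation ℚ A B) :
    ∃ D : Derivation ℚ B B, ∀ a, D (algebraMap A B a) = d a := by
  let e := KaehlerDifferential.tensorKaehlerEquivOfFormallyEtale ℚ A B
  let f := (d.liftKaehlerDifferential.liftBaseChange B) ∘ₗ e.symm.toLinearMap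
  refine ⟨f.compDer (KaehlerDifferential.D ℚ B), fun a => ?_⟩
  change d.liftKaehlerDifferential.liftBaseChange B
    (e.symm (KaehlerDifferential.D ℚ B (algebraMap A B a))) = _
  rw [KaehlerDifferential.tensorKaehlerEquivOfFormallyEtale_symm_D_algebraMap]
  simp

/-- A derivation of a field of characteristic zero extends to any algebraic extension. -/
theorem Derivation.exists_extension_of_isAlgebraic {K E : Type*} [Field K] [CharZero K] [Field E]
    [CharZero E] [Algebra K E] [Algebra.IsAlgebraic K E] (d : Derivation ℚ K K) :
    ∃ D : Derivation ℚ E E, ∀ a, D (algebraMap K E a) = algebraMap K E (d a) := by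
  have : Algebra.FormallyEtale K E := Algebra.FormallyEtale.of_isSeparable K E
  exact Derivation.exists_extension ((Algebra.linearMap K E).compDer d)

section AlgebraicExtension

variable {K E : Type*} [Field K] [CharZero K] [Field E] [CharZero E] [Algebra K E]
  [Algebra.IsAlgebraic K E] (d : Derivation ℚ K K) (D : Derivation ℚ E E)
  (hD : ∀ a, D (algebraMap K E a) = algebraMap K E (d a))

include hD in
theorem derivation_apply_algEquiv (σ : E ≃ₐ[K] E) (z : E) : D (σ z) = σ (D z) := by
  let D' : Derivation ℚ E E := Derivation.mk'
    { toFun := fun z => σ.symm (D (σ z))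
      map_add' := fun a b => by simp
      map_smul' := fun c a => by
        simp only [map_rat_smul, RingHom.id_apply] } (fun a b => by simp)
  have h : (D' - D) z = 0 := by
    refine (D' - D).eq_zero_of_isAlgebraic (K := K) (fun a => ?_)
      (Algebra.IsAlgebraic.isAlgebraic z)
    simp [D', hD]
  have h' : σ.symm (D (σ z)) = D z := sub_eq_zero.1 h
  rw [← h', AlgEquiv.apply_symm_apply]

theorem logDerivation_prod {ι : Type*} (s : Finset ι) (f : ι → E) (hf : ∀ i ∈ s, f i ≠ 0) :
    D (∏ i ∈ s, f i) / ∏ i ∈ s, f i = ∑ i ∈ s, D (f i) / f i := by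
  classical
  induction s using Finset.induction_on with
  | empty => simp
  | insert a s ha ih =>
    have h1 := hf a (Finset.mem_insert_self a s)
    have h2 : ∏ i ∈ s, f i ≠ 0 :=
      Finset.prod_ne_zero_iff.2 fun i hi => hf i (Finset.mem_insert_of_mem hi)
    rw [Finset.sum_insert ha, ← ih fun i hi => hf i (Finset.mem_insert_of_mem hi),
      Finset.prod_insert ha, Derivation.leibniz]
    simp only [smul_eq_mul]
    field_simp
    ring

include hD in
/-- Taking norms and traces, an identity between a combination of logarithmic derivatives and
a derivative descends along an algebraic extension. -/
theorem exists_sum_logDerivation_eq_of_isAlgClosed [IsAlgClosed E] {ι : Type*} [Fintype ι]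
    (e : ι → K) (Y : ι → E) (hY : ∀ j, Y j ≠ 0) (Z : E)
    (h : ∑ j, algebraMap K E (e j) * (D (Y j) / Y j) = D Z) :
    ∃ (P : ι → K) (Q : K), (∀ j, P j ≠ 0) ∧ ∑ j, e j * (d (P j) / P j) = d Q ∧
      ∃ N : ℕ, N ≠ 0 ∧ ∀ j a, Y j = algebraMap K E a → P j = a ^ N := by
  let S : Set E := insert Z (Set.range Y)
  let M := IntermediateField.adjoin K S
  have hfin : FiniteDimensional K M :=
    have : Finite S := ((Set.finite_range Y).insert Z).to_subtype
    IntermediateField.finiteDimensional_adjoin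
      fun x _ => (Algebra.IsAlgebraic.isAlgebraic (R := K) x).isIntegral
  let Y' : ι → M := fun j =>
    ⟨Y j, IntermediateField.subset_adjoin K S (Set.mem_insert_of_mem _ ⟨j, rfl⟩)⟩
  let Z' : M := ⟨Z, IntermediateField.subset_adjoin K S (Set.mem_insert _ _)⟩
  have hY' : ∀ j, Y' j ≠ 0 := fun j h0 => hY j (congrArg Subtype.val h0)
  refine ⟨fun j => Algebra.norm K (Y' j), Algebra.trace K M Z',
    fun j => Algebra.norm_ne_zero_iff.2 (hY' j), ?_, Module.finrank K M,
    Module.finrank_pos.ne', fun j a ha => ?_⟩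
  · have : IsAlgClosure K E := ⟨inferInstance, inferInstance⟩
    have : Normal K E := IsAlgClosure.normal K E
    apply (algebraMap K E).injective
    have hnorm : ∀ j, algebraMap K E (Algebra.norm K (Y' j)) = ∏ σ : M →ₐ[K] E, σ (Y' j) :=
      fun j => Algebra.norm_eq_prod_embeddings K E (Y' j)
    have htrace : algebraMap K E (Algebra.trace K M Z') = ∑ σ : M →ₐ[K] E, σ Z' :=
      trace_eq_sum_embeddings E
    rw [← hD, htrace, map_sum, map_sum]
    simp only [map_mul, map_div₀, ← hD, hnorm]
    have hlog : ∀ j, D (∏ σ : M →ₐ[K] E, σ (Y' j)) / ∏ σ : M →ₐ[K] E, σ (Y' j) =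
        ∑ σ : M →ₐ[K] E, D (σ (Y' j)) / σ (Y' j) := fun j =>
      logDerivation_prod D _ _ fun σ _ => (map_ne_zero σ).2 (hY' j)
    simp only [hlog, Finset.mul_sum]
    rw [Finset.sum_comm]
    refine Finset.sum_congr rfl fun σ _ => ?_
    obtain ⟨τ, hτ⟩ : ∃ τ : E ≃ₐ[K] E, ∀ m : M, σ m = τ m := by
      obtain ⟨φ, hφ⟩ := IsAlgClosed.surjective_domRestrict_of_isAlgebraic (M := E) (E := E) σ
      refine ⟨AlgEquiv.ofBijective φ (AlgHom.normal_bijective K E E φ), fun m => ?_⟩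
      rw [← hφ]
      rfl
    simp only [hτ, derivation_apply_algEquiv d D hD]
    change _ = τ (D Z)
    rw [← h, map_sum]
    simp [Y']
  · have : Y' j = algebraMap K M a := Subtype.ext ha
    change Algebra.norm K (Y' j) = _
    rw [this, Algebra.norm_algebraMap]

end AlgebraicExtension

theorem exists_derivation_ratFunc (L : Type*) [Field L] [CharZero L] :
    ∃ d : Derivation ℚ (RatFunc L) (RatFunc L), ∀ p : L[X],
      d (algebraMap L[X] (RatFunc L) p) = algebraMap L[X] (RatFunc L) (derivative p) := by
  have : Algebra.FormallyEtale L[X] (RatFunc L) :=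
    Algebra.FormallyEtale.of_isLocalization (nonZeroDivisors L[X])
  obtain ⟨d, hd⟩ := Derivation.exists_extension (B := RatFunc L)
    ((Algebra.linearMap L[X] (RatFunc L)).compDer
      ((Polynomial.derivative' (R := L)).restrictScalars ℚ))
  exact ⟨d, hd⟩

theorem ne_X_of_sum_logDerivation_eq {L F : Type*} [Field L] [CharZero L] [Field F] [CharZero F]
    [Algebra (RatFunc L) F] [Algebra.IsAlgebraic (RatFunc L) F] {ι : Type*} [Fintype ι]
    (e : ι → L) (he : LinearIndependent ℤ e) (Y : ι → F) (hY : ∀ j, Y j ≠ 0) (Z : F)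
    (h : ∀ δ : Derivation ℚ F F, (∀ a : L, δ (algebraMap (RatFunc L) F (RatFunc.C a)) = 0) →
      ∑ j, algebraMap (RatFunc L) F (RatFunc.C (e j)) * (δ (Y j) / Y j) = δ Z) (j : ι) :
    Y j ≠ algebraMap (RatFunc L) F RatFunc.X := by
  intro hj
  obtain ⟨d, hd⟩ := exists_derivation_ratFunc L
  obtain ⟨δ, hδ⟩ := Derivation.exists_extension_of_isAlgebraic (E := F) d
  obtain ⟨D, hD⟩ := Derivation.exists_extension_of_isAlgebraic (E := AlgebraicClosure F) δ
  have : Algebra.IsAlgebraic (RatFunc L) (AlgebraicClosure F) :=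
    Algebra.IsAlgebraic.trans (RatFunc L) F (AlgebraicClosure F)
  have hDd : ∀ a, D (algebraMap (RatFunc L) (AlgebraicClosure F) a) =
      algebraMap (RatFunc L) (AlgebraicClosure F) (d a) := fun a => by
    rw [IsScalarTower.algebraMap_apply (RatFunc L) F (AlgebraicClosure F), hD, hδ,
      ← IsScalarTower.algebraMap_apply]
  have hrel := congrArg (algebraMap F (AlgebraicClosure F)) (h δ fun a => by
    rw [hδ, ← RatFunc.algebraMap_C, hd, derivative_C, map_zero, map_zero])
  rw [← hD, map_sum] at hrel
  simp only [map_mul, map_div₀, ← hD, ← IsScalarTower.algebraMap_apply (RatFunc L) F] at hrel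
  obtain ⟨P, Q, hP, hPQ, N, hN, hPN⟩ := exists_sum_logDerivation_eq_of_isAlgClosed d D hDd
    (fun j => RatFunc.C (e j)) (fun j => algebraMap F (AlgebraicClosure F) (Y j))
    (fun j => by simpa using hY j) _ hrel
  refine RatFunc.ne_X_pow_of_sum_logDeriv_eq d hd e he P hP Q hPQ j hN (hPN j _ ?_)
  rw [hj, ← IsScalarTower.algebraMap_apply]

/-- Every transcendental element `t` of an extension `F / C` is transcendental over some
intermediate field `L` such that `F` is algebraic over `L(t)`. -/
theorem exists_intermediateField_transcendental {C F : Type*} [Field C] [Field F] [Algebra C F]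
    {t : F} (ht : Transcendental C t) :
    ∃ L : IntermediateField C F, Transcendental L t ∧
      Algebra.IsAlgebraic (IntermediateField.adjoin L {t}) F := by
  have hind : AlgebraicIndepOn C id ({t} : Set F) :=
    (algebraicIndependent_singleton_iff (⟨t, rfl⟩ : ({t} : Set F))).2 ht
  obtain ⟨s, hts, hs⟩ := exists_isTranscendenceBasis_superset hind
  rw [Set.singleton_subset_iff] at hts
  let L := IntermediateField.adjoin C (s \ {t})
  refine ⟨L, ?_, ⟨fun z => ?_⟩⟩
  · rw [IntermediateField.transcendental_adjoin_iff]
    have himg : Subtype.val '' ({(⟨t, hts⟩ : s)}ᶜ : Set s) = s \ {t} := by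
      ext z
      simp
    have htr := hs.1.transcendental_adjoin (s := {(⟨t, hts⟩ : s)}ᶜ) (i := ⟨t, hts⟩) (by simp)
    rwa [himg] at htr
  · have halg := hs.isAlgebraic_field
    rw [Subtype.range_coe] at halg
    have hle : IntermediateField.adjoin C s ≤
        (IntermediateField.adjoin L {t}).restrictScalars C := by
      refine IntermediateField.adjoin_le_iff.2 fun z hz => ?_
      by_cases hzt : z = t
      · exact hzt ▸ IntermediateField.mem_adjoin_simple_self L t
      · exact (IntermediateField.adjoin L {t}).algebraMap_mem
          ⟨z, IntermediateField.subset_adjoin C _ ⟨hz, hzt⟩⟩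
    let f : IntermediateField.adjoin C s →+* IntermediateField.adjoin L {t} :=
      (IntermediateField.inclusion hle).toRingHom
    exact (halg.isAlgebraic z).ringHom_of_comp_eq f (RingHom.id F) f.injective rfl

/-- If a combination of logarithmic differentials with `ℤ`-linearly independent constant
coefficients is exact, then the elements involved are algebraic over the constants. -/
theorem isAlgebraic_of_sum_logDerivation_eq {F : Type*} [Field F] [CharZero F] (C : Subfield F)
    {ι : Type*} [Fintype ι] (e : ι → F) (heC : ∀ j, e j ∈ C) (he : LinearIndependent ℤ e)
    (Y : ι → F) (hY : ∀ j, Y j ≠ 0) (Z : F)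
    (h : ∀ δ : Derivation ℚ F F, (∀ a ∈ C, δ a = 0) → ∑ j, e j * (δ (Y j) / Y j) = δ Z)
    (j : ι) : IsAlgebraic C (Y j) := by
  by_contra htr
  obtain ⟨L, hL, halg⟩ := exists_intermediateField_transcendental (C := C) htr
  let φ := RatFunc.algEquivOfTranscendental (Y j) hL
  let _ : Algebra (RatFunc L) F :=
    ((algebraMap (IntermediateField.adjoin L {Y j}) F).comp (φ : RatFunc L →+* _)).toAlgebra
  have hφ : ∀ a : L, algebraMap (RatFunc L) F (RatFunc.C a) = a := fun a => by
    change ((φ (RatFunc.C a) : IntermediateField.adjoin L {Y j}) : F) = a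
    rw [← RatFunc.algebraMap_eq_C, φ.commutes]
    rfl
  have : Algebra.IsAlgebraic (RatFunc L) F :=
    halg.of_ringHom_of_comp_eq (φ : RatFunc L →+* IntermediateField.adjoin L {Y j})
      (RingHom.id F) φ.surjective Function.injective_id rfl
  let e' : ι → L := fun j => algebraMap C L ⟨e j, heC j⟩
  have he' : LinearIndependent ℤ e' :=
    LinearIndependent.of_comp ((algebraMap L F).toAddMonoidHom.toIntLinearMap) he
  refine ne_X_of_sum_logDerivation_eq e' he' Y hY Z (fun δ hδ => ?_) j ?_
  · simp only [hφ] at hδ ⊢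
    exact h δ fun a ha => hδ (algebraMap C L ⟨a, ha⟩)
  · exact (RatFunc.algEquivOfTranscendental_X (Y j) hL).symm

theorem logDerivation_prod_zpow {F : Type*} [Field F] [CharZero F] (D : Derivation ℚ F F)
    {ι : Type*} [Fintype ι] (y : ι → F) (hy : ∀ i, y i ≠ 0) (m : ι → ℤ) :
    D (∏ i, y i ^ m i) / ∏ i, y i ^ m i = ∑ i, (m i : F) * (D (y i) / y i) := by
  rw [logDerivation_prod D _ _ fun i _ => zpow_ne_zero _ (hy i)]
  refine Finset.sum_congr rfl fun i _ => ?_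
  have := hy i
  have := zpow_ne_zero (m i) (hy i)
  rw [Derivation.leibniz_zpow, smul_eq_mul, zsmul_eq_mul, zpow_sub_one₀ (hy i)]
  field_simp

/-- A nonzero family in a characteristic zero field is an integral combination, with a nonzero
coefficient matrix, of finitely many `ℤ`-linearly independent elements of any additive subgroup
containing it. -/
theorem exists_linearIndependent_int_combination {F : Type*} [Field F] [CharZero F]
    (G : AddSubgroup F) {n : ℕ} (c : Fin n → F) (hc0 : c ≠ 0) (hcG : ∀ i, c i ∈ G) :
    ∃ (k : ℕ) (e : Fin k → F) (m : Fin k → Fin n → ℤ), LinearIndependent ℤ e ∧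
      (∀ j, e j ∈ G) ∧ (∀ i, c i = ∑ j, (m j i : F) * e j) ∧ ∃ j, m j ≠ 0 := by
  let S := Submodule.span ℤ (Set.range c)
  have : Module.Finite ℤ S := Module.Finite.span_of_finite ℤ (Set.finite_range c)
  let b := Module.finBasis ℤ S
  have hc : ∀ i, c i ∈ S := fun i => Submodule.subset_span ⟨i, rfl⟩
  have hSG : S ≤ AddSubgroup.toIntSubmodule G :=
    Submodule.span_le.2 (Set.range_subset_iff.2 hcG)
  have hrepr : ∀ i, c i = ∑ j, (b.repr ⟨c i, hc i⟩ j : F) * (b j : F) := by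
    intro i
    have hsum := congrArg S.subtype (b.sum_repr ⟨c i, hc i⟩)
    rw [map_sum] at hsum
    refine hsum.symm.trans (Finset.sum_congr rfl fun j _ => ?_)
    rw [map_zsmul]
    exact zsmul_eq_mul _ _
  refine ⟨_, fun j => (b j : F), fun j i => b.repr ⟨c i, hc i⟩ j,
    b.linearIndependent.map' S.subtype S.ker_subtype, fun j => hSG (b j).2, hrepr, ?_⟩
  by_contra! h0
  refine hc0 (funext fun i => ?_)
  rw [hrepr i]
  refine Finset.sum_eq_zero fun j _ => ?_
  have := congrFun (h0 j) i
  simp only [Pi.zero_apply] at this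
  rw [this, Int.cast_zero, zero_mul]

/-- **Ax's theorem (SC_D), differential field Schanuel condition.**
If `x i, y i ∈ F` with `y i ≠ 0` and `D (y i) = y i * D (x i)` for all `D ∈ Δ`,
and the transcendence degree of `C(x₁,y₁,…,xₙ,yₙ)` over the constant field `C`
is less than `n` plus the rank of the Jacobian of `x`, then there are integers
`m i`, not all zero, with `∑ m i • x i ∈ C` and `∏ (y i)^(m i) ∈ C`. -/
theorem ax_schanuel_differential
    (F : Type*) [Field F] [CharZero F] (Δ : Set (Derivation ℚ F F))
    (n : ℕ) (x y : Fin n → F) (hy : ∀ i, y i ≠ 0)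
    (hexp : ∀ D ∈ Δ, ∀ i, D (y i) = y i * D (x i))
    (htd : trdeg (constants F Δ)
        (IntermediateField.adjoin (constants F Δ) (Set.range x ∪ Set.range y))
      < (n : Cardinal) + Module.rank F
          (Submodule.span F {v : Fin n → F | ∃ D ∈ Δ, v = fun i => D (x i)})) :
    ∃ m : Fin n → ℤ, m ≠ 0 ∧ (∑ i, m i • x i) ∈ constants F Δ ∧
      (∏ i, y i ^ m i) ∈ constants F Δ := by
  obtain ⟨c, hc0, hcC, hc⟩ := exists_constant_relation Δ n x y hy hexp htd
  obtain ⟨k, e, m, he, heC, hcm, j, hj⟩ :=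
    exists_linearIndependent_int_combination (constants F Δ).toAddSubgroup c hc0 hcC
  have hY : (∏ i, y i ^ m j i) ∈ constants F Δ := by
    refine mem_constants_of_isAlgebraic (isAlgebraic_of_sum_logDerivation_eq (constants F Δ) e heC
      he (fun j => ∏ i, y i ^ m j i)
      (fun j => Finset.prod_ne_zero_iff.2 fun i _ => zpow_ne_zero _ (hy i))
      (∑ i, c i * x i) (fun δ hδ => ?_) j)
    have hsum : ∑ i, c i * (δ (y i) / y i) = ∑ i, c i * δ (x i) := by
      rw [← sub_eq_zero, ← Finset.sum_sub_distrib, ← hc δ hδ]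
      exact Finset.sum_congr rfl fun i _ => (mul_sub _ _ _).symm
    calc ∑ j, e j * (δ (∏ i, y i ^ m j i) / ∏ i, y i ^ m j i)
        = ∑ i, c i * (δ (y i) / y i) := by
          simp only [logDerivation_prod_zpow δ y hy, Finset.mul_sum]
          rw [Finset.sum_comm]
          refine Finset.sum_congr rfl fun i _ => ?_
          rw [hcm i, Finset.sum_mul]
          exact Finset.sum_congr rfl fun j _ => by ring
      _ = δ (∑ i, c i * x i) := by
          rw [hsum, map_sum]
          exact Finset.sum_congr rfl fun i _ => by simp [hδ _ (hcC i)]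
  refine ⟨m j, hj, fun D hD => ?_, hY⟩
  have h := logDerivation_prod_zpow D y hy (m j)
  rw [hY D hD, zero_div] at h
  rw [map_sum, h]
  refine Finset.sum_congr rfl fun i _ => ?_
  rw [map_zsmul, hexp D hD i, mul_div_cancel_left₀ _ (hy i), zsmul_eq_mul]
end

section
/- Schanuel's conjecture (SC) holds if and only if Schanuel's conjecture over the kernel holds, where the latter states: for every n and all complex numbers a₁,…,aₙ, the transcendence degree of ℚ(πi, a₁, exp a₁, …, aₙ, exp aₙ) over ℚ(πi) is at least dim_ℚ span_ℚ{a₁,…,aₙ, πi} − 1. -/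
set_option maxHeartbeats 1000000
set_option synthInstance.maxHeartbeats 400000

/-- Schanuel's conjecture: for all `ℚ`-linearly independent complex numbers
`a₁,…,aₙ`, the transcendence degree of `ℚ(a₁, exp a₁, …, aₙ, exp aₙ)` over `ℚ`
is at least `n`. -/
def SchanuelConjecture : Prop :=
  ∀ (n : ℕ) (a : Fin n → ℂ), LinearIndependent ℚ a →
    (n : Cardinal) ≤ trdeg ℚ (IntermediateField.adjoin ℚ
      (Set.range a ∪ Set.range fun i => Complex.exp (a i)))

/-- Schanuel's conjecture over the kernel: for all complex `a₁,…,aₙ`, the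
transcendence degree of `ℚ(πi, a₁, exp a₁, …, aₙ, exp aₙ)` over `ℚ(πi)` is at least
`dim_ℚ span_ℚ {a₁,…,aₙ, πi} - 1` (stated as `dim ≤ trdeg + 1`). -/
def SchanuelOverKernel : Prop :=
  ∀ (n : ℕ) (a : Fin n → ℂ),
    Module.rank ℚ (Submodule.span ℚ (insert ((Real.pi : ℂ) * Complex.I) (Set.range a)))
      ≤ trdeg (IntermediateField.adjoin ℚ {((Real.pi : ℂ) * Complex.I)})
          (IntermediateField.adjoin (IntermediateField.adjoin ℚ {((Real.pi : ℂ) * Complex.I)})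
            (Set.range a ∪ Set.range fun i => Complex.exp (a i))) + 1

section PiTranscendental

open Polynomial

theorem Multiset.exists_int_polynomial_vanishing {K : Type*} [Field K] [Algebra ℤ K]
    (m : Multiset K) (h0 : (0 : K) ∉ m) (hm : ∀ x ∈ m, IsAlgebraic ℤ x) :
    ∃ f : ℤ[X], f.coeff 0 ≠ 0 ∧ ∀ x ∈ m, aeval x f = 0 := by
  induction m using Multiset.induction with
  | empty => exact ⟨1, by simp, by simp⟩
  | cons a m ih =>
    simp only [Multiset.mem_cons, not_or] at h0
    obtain ⟨f, hf, hfm⟩ := ih h0.2 fun x hx => hm x (Multiset.mem_cons_of_mem hx)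
    obtain ⟨g, hg, hga⟩ := (hm a (Multiset.mem_cons_self a m)).exists_nonzero_coeff_and_aeval_eq_zero
      (mem_nonZeroDivisors_of_ne_zero (Ne.symm h0.1))
    refine ⟨g * f, by simp [mul_coeff_zero, hf, hg], fun x hx => ?_⟩
    rcases Multiset.mem_cons.1 hx with rfl | hx
    · simp [hga]
    · simp [hfm x hx]

theorem IsIntegral.pow_smul_aeval {R S : Type*} [CommRing R] [CommRing S] [Algebra R S] {a : R}
    {x : S} (hx : IsIntegral R (a • x)) (g : R[X]) {N : ℕ} (hN : g.natDegree ≤ N) :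
    IsIntegral R (a ^ N • aeval x g) := by
  rw [aeval_eq_sum_range, Finset.smul_sum]
  refine IsIntegral.sum _ fun i hi => ?_
  have hi : i ≤ N := (Finset.mem_range_succ_iff.1 hi).trans hN
  have : a ^ N • g.coeff i • x ^ i = (a ^ (N - i) * g.coeff i) • (a • x) ^ i := by
    rw [_root_.smul_pow, smul_smul, smul_smul, ← Nat.sub_add_cancel hi, pow_add, Nat.add_sub_cancel]
    congr 1
    ring
  rw [this]
  exact (hx.pow i).smul _

/-- A Galois-stable sum of integer polynomial values is an integer after clearing denominators. -/
theorem exists_int_eq_pow_smul_sum_aeval {K : Type*} [Field K] [Algebra ℚ K]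
    [FiniteDimensional ℚ K] [IsGalois ℚ K] (m : Multiset K)
    (hm : ∀ σ : K ≃ₐ[ℚ] K, m.map σ = m) {a : ℤ} (ha : ∀ x ∈ m, IsIntegral ℤ (a • x))
    (g : ℤ[X]) {N : ℕ} (hN : g.natDegree ≤ N) :
    ∃ z : ℤ, (z : K) = a ^ N • (m.map fun x => aeval x g).sum := by
  have hint : IsIntegral ℤ (a ^ N • (m.map fun x => aeval x g).sum) := by
    rw [Multiset.smul_sum, Multiset.map_map]
    refine IsIntegral.multiset_sum fun y hy => ?_
    obtain ⟨x, hx, rfl⟩ := Multiset.mem_map.1 hy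
    exact (ha x hx).pow_smul_aeval g hN
  have hbot : a ^ N • (m.map fun x => aeval x g).sum ∈ (⊥ : IntermediateField ℚ K) := by
    rw [IsGalois.mem_bot_iff_fixed]
    intro σ
    rw [map_zsmul, map_multiset_sum, Multiset.map_map]
    conv_rhs => rw [← hm σ, Multiset.map_map]
    congr 3
    funext x
    exact (aeval_algHom_apply ((σ : K →ₐ[ℚ] K).restrictScalars ℤ) x g).symm
  obtain ⟨q, hq⟩ := IntermediateField.mem_bot.1 hbot
  rw [← hq, isIntegral_algebraMap_iff (algebraMap ℚ K).injective] at hint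
  obtain ⟨z, rfl⟩ := IsIntegrallyClosed.isIntegral_iff.1 hint
  exact ⟨z, by simpa using hq⟩

/-- A nonzero integer plus the sum of the exponentials of a Galois-stable multiset of nonzero
algebraic numbers is nonzero. -/
theorem intCast_add_sum_exp_ne_zero {K : Type*} [Field K] [Algebra ℚ K] [FiniteDimensional ℚ K]
    [IsGalois ℚ K] (φ : K →ₐ[ℚ] ℂ) (m : Multiset K) (h0 : (0 : K) ∉ m)
    (hm : ∀ σ : K ≃ₐ[ℚ] K, m.map σ = m) {k : ℤ} (hk : k ≠ 0) :
    (k : ℂ) + (m.map fun x => Complex.exp (φ x)).sum ≠ 0 := by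
  intro hsum
  obtain ⟨f, hf0, hfm⟩ := m.exists_int_polynomial_vanishing h0 fun x _ =>
    (IsFractionRing.isAlgebraic_iff ℤ ℚ K).2 (Algebra.IsAlgebraic.isAlgebraic x)
  have hf : f ≠ 0 := by rintro rfl; simp at hf0
  set a := f.leadingCoeff
  have ha : a ≠ 0 := leadingCoeff_ne_zero.2 hf
  obtain ⟨c, hc⟩ := LindemannWeierstrass.exp_polynomial_approx f (by rwa [← coeff_zero_eq_eval_zero])
  have key : ∀ p : ℕ, (eval 0 f).natAbs < p → p.Prime → a.natAbs < p → k.natAbs < p →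
      1 ≤ (m.card : ℝ) * (|(a : ℝ)| ^ f.natDegree * c) ^ p / (p - 1).factorial := by
    intro p hp hpp hpa hpk
    obtain ⟨n, hpn, g, hgdeg, hg⟩ := hc p hp hpp
    obtain ⟨z, hz⟩ := exists_int_eq_pow_smul_sum_aeval m hm
      (fun x hx => isIntegral_leadingCoeff_smul f x (hfm x hx)) g
      (hgdeg.trans (Nat.sub_le _ _))
    have hzC : (z : ℂ) = (a : ℂ) ^ (p * f.natDegree) * (m.map fun x => aeval (φ x) g).sum := by
      have := congrArg φ hz
      rw [map_intCast, map_zsmul, map_multiset_sum, Multiset.map_map, zsmul_eq_mul] at this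
      rw [this]
      push_cast
      congr 3
      funext x
      exact (aeval_algHom_apply (φ.restrictScalars ℤ) x g).symm
    have hprime : Prime (p : ℤ) := Nat.prime_iff_prime_int.1 hpp
    have hndvd : ∀ b : ℤ, b ≠ 0 → b.natAbs < p → ¬ (p : ℤ) ∣ b := fun b hb hbp hd =>
      absurd (Nat.le_of_dvd (Int.natAbs_pos.2 hb) (Int.natCast_dvd.1 hd)) (not_le.2 hbp)
    have hne : a ^ (p * f.natDegree) * n * k + p * z ≠ 0 := by
      intro h
      have : (p : ℤ) ∣ a ^ (p * f.natDegree) * n * k :=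
        (dvd_add_left (dvd_mul_right _ _)).1 (h ▸ dvd_zero _)
      rcases hprime.dvd_or_dvd this with h | h
      · rcases hprime.dvd_or_dvd h with h | h
        · exact hndvd a ha hpa (hprime.dvd_of_dvd_pow h)
        · exact hpn h
      · exact hndvd k hk hpk h
    have hone : (1 : ℝ) ≤ ‖((a ^ (p * f.natDegree) * n * k + p * z : ℤ) : ℂ)‖ := by
      rw [Complex.norm_intCast]
      exact_mod_cast Int.one_le_abs hne
    have heq : ((a ^ (p * f.natDegree) * n * k + p * z : ℤ) : ℂ) =
        -((a : ℂ) ^ (p * f.natDegree) *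
          (m.map fun x => n • Complex.exp (φ x) - p • aeval (φ x) g).sum) := by
      rw [Multiset.sum_map_sub, Multiset.sum_map_zsmul, Multiset.sum_map_nsmul,
        eq_neg_of_add_eq_zero_right hsum, zsmul_eq_mul, nsmul_eq_mul]
      push_cast
      rw [hzC]
      ring
    rw [heq, norm_neg, norm_mul, norm_pow, Complex.norm_intCast] at hone
    have hbound : ‖(m.map fun x => n • Complex.exp (φ x) - p • aeval (φ x) g).sum‖ ≤
        m.card * (c ^ p / (p - 1).factorial) := by
      refine (norm_multiset_sum_le _).trans ?_
      rw [Multiset.map_map, ← nsmul_eq_mul]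
      refine (Multiset.sum_le_card_nsmul _ _ fun y hy => ?_).trans_eq (by rw [Multiset.card_map])
      obtain ⟨x, hx, rfl⟩ := Multiset.mem_map.1 hy
      refine hg ((mem_aroots).2 ⟨hf, ?_⟩)
      have := congrArg φ (hfm x hx)
      rw [map_zero] at this
      exact (aeval_algHom_apply (φ.restrictScalars ℤ) x f).trans this
    refine hone.trans ((mul_le_mul_of_nonneg_left hbound (by positivity)).trans_eq ?_)
    rw [mul_pow, ← pow_mul, mul_comm p]
    ring
  have hlim := FloorSemiring.tendsto_mul_pow_div_factorial_sub_atTop (m.card : ℝ)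
    (|(a : ℝ)| ^ f.natDegree * c) 1
  have hev := (hlim.eventually_lt_const zero_lt_one).and
    (Filter.eventually_gt_atTop (max (eval 0 f).natAbs (max a.natAbs k.natAbs)))
  obtain ⟨p, ⟨hlt, hp⟩, hpp⟩ := (hev.and_frequently
    (Filter.frequently_atTop.2 fun n => (Nat.exists_infinite_primes n).imp fun _ h => h)).exists
  simp only [max_lt_iff] at hp
  exact absurd (key p hp.1 hpp hp.2.1 hp.2.2) (not_le.2 hlt)

theorem Multiset.map_map_sum_powerset {M N F : Type*} [AddCommMonoid M] [AddCommMonoid N]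
    [FunLike F M N] [AddMonoidHomClass F M N] (σ : F) (A : Multiset M) :
    (A.powerset.map Multiset.sum).map σ = (A.map σ).powerset.map Multiset.sum := by
  induction A using Multiset.induction with
  | empty => simp
  | cons a A ih =>
    simp only [Multiset.map_map, Function.comp_def] at ih
    simp only [Multiset.map_cons, Multiset.powerset_cons, Multiset.map_add, Multiset.map_map,
      Function.comp_def, Multiset.sum_cons, _root_.map_add, ih]
    congr 1
    simpa only [Multiset.map_map, Function.comp_def] using congrArg (Multiset.map (σ a + ·)) ih

theorem Complex.sum_exp_sum_powerset (A : Multiset ℂ) :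
    ((A.powerset.map Multiset.sum).map Complex.exp).sum =
      (A.map fun x => 1 + Complex.exp x).prod := by
  induction A using Multiset.induction with
  | empty => simp
  | cons a A ih =>
    simp only [Multiset.map_map, Function.comp_def] at ih
    simp [Multiset.powerset_cons, Complex.exp_add, Multiset.sum_map_mul_left, ih, add_mul]

theorem aeval_pi_mul_I_ne_zero {p : ℚ[X]} (hirr : Irreducible p) (K : Type*) [Field K]
    [Algebra ℚ K] [IsSplittingField ℚ K p] : aeval ((Real.pi : ℂ) * Complex.I) p ≠ 0 := by
  intro hroot
  have : FiniteDimensional ℚ K := IsSplittingField.finiteDimensional K p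
  have : IsGalois ℚ K := IsGalois.of_separable_splitting_field hirr.separable
  have hsplits := IsSplittingField.splits K p
  let φ : K →ₐ[ℚ] ℂ := IsAlgClosed.lift
  set A := p.aroots K
  have hA : ∀ σ : K ≃ₐ[ℚ] K, A.map σ = A := fun σ => by
    have := hsplits.roots_map ((σ : K →ₐ[ℚ] K) : K →+* K)
    rw [Polynomial.map_map, AlgHom.comp_algebraMap] at this
    exact this.symm
  have hφ : (Real.pi : ℂ) * Complex.I ∈ A.map φ := by
    have := hsplits.roots_map (φ : K →+* ℂ)
    rw [Polynomial.map_map, AlgHom.comp_algebraMap] at this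
    exact this ▸ mem_aroots.2 ⟨hirr.ne_zero, hroot⟩
  set M := A.powerset.map Multiset.sum with hM_def
  have hM : ∀ σ : K ≃ₐ[ℚ] K, M.map σ = M := fun σ => by
    rw [hM_def, Multiset.map_map_sum_powerset, hA]
  have hsum : (M.map fun x => Complex.exp (φ x)).sum = 0 := by
    have h1 := Complex.sum_exp_sum_powerset (A.map φ)
    rw [← Multiset.map_map_sum_powerset, Multiset.map_map] at h1
    exact h1.trans (Multiset.prod_eq_zero
      (Multiset.mem_map.2 ⟨_, hφ, by rw [Complex.exp_pi_mul_I]; norm_num⟩))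
  classical
  refine intCast_add_sum_exp_ne_zero φ (M.filter (· ≠ 0)) (by simp) (fun σ => ?_)
    (k := M.count 0) ?_ ?_
  · conv_rhs => rw [← hM σ, Multiset.filter_map]
    simp
  · have : (0 : K) ∈ M :=
      Multiset.mem_map.2 ⟨0, Multiset.zero_mem_powerset A, Multiset.sum_zero⟩
    exact_mod_cast (Multiset.count_pos.2 this).ne'
  · rw [← hsum]
    conv_rhs => rw [← Multiset.filter_add_not (· ≠ 0) M]
    rw [Multiset.map_add, Multiset.sum_add, add_comm]
    have : M.filter (¬ · ≠ 0) = Multiset.replicate (M.count 0) 0 := by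
      simp_rw [not_not]
      exact Multiset.filter_eq' M 0
    rw [this]
    simp

/-- **Lindemann's theorem**: `πi` is transcendental. -/
theorem transcendental_pi_mul_I : Transcendental ℚ ((Real.pi : ℂ) * Complex.I) := fun halg =>
  @aeval_pi_mul_I_ne_zero _ (minpoly.irreducible halg.isIntegral)
    (minpoly ℚ ((Real.pi : ℂ) * Complex.I)).SplittingField _ _
    (IsSplittingField.splittingField _) (minpoly.aeval _ _)

end PiTranscendental

open IntermediateField in
/-- Additivity of the transcendence degree in the tower `F ⊆ F(S) ⊆ F(S ∪ T)`. -/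
theorem trdeg_adjoin_add_trdeg_adjoin {F E : Type*} [Field F] [Field E] [Algebra F E]
    (S T : Set E) :
    trdeg F (adjoin F S) + trdeg (adjoin F S) (adjoin (adjoin F S) T) =
      trdeg F (adjoin F (S ∪ T)) := by
  refine (trdeg_add_eq F (adjoin F S) (A := adjoin (adjoin F S) T)).trans ?_
  rw [← adjoin_adjoin_left]
  rfl

open IntermediateField in
theorem trdeg_adjoin_mono {F E : Type*} [Field F] [Field E] [Algebra F E] {S T : Set E}
    (h : S ⊆ adjoin F T) : trdeg F (adjoin F S) ≤ trdeg F (adjoin F T) :=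
  trdeg_le_of_injective (inclusion (adjoin_le_iff.2 h))
    (RingHom.injective (inclusion (adjoin_le_iff.2 h)).toRingHom)

open IntermediateField algebraAdjoinAdjoin in
theorem trdeg_adjoin_singleton_le {F E : Type*} [Field F] [Field E] [Algebra F E] (x : E) :
    trdeg F (adjoin F {x}) ≤ 1 := by
  have hadj : Algebra.trdeg F (Algebra.adjoin F {x}) ≤ 1 := by
    have hrange := (Algebra.adjoin_singleton_eq_range_aeval F x).le
    refine (trdeg_le_of_injective (Subalgebra.inclusion hrange)
      (Subalgebra.inclusion_injective hrange)).trans ?_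
    simpa [Polynomial.trdeg_of_isDomain] using lift_trdeg_le_of_surjective
      (Polynomial.aeval (R := F) x).rangeRestrict (Polynomial.aeval x).rangeRestrict_surjective
  refine (trdeg_add_eq F (Algebra.adjoin F {x}) (A := adjoin F {x})).symm.trans_le ?_
  rwa [trdeg_eq_zero (R := Algebra.adjoin F {x}), add_zero]

open IntermediateField in
theorem trdeg_adjoin_singleton {F E : Type*} [Field F] [Field E] [Algebra F E] {x : E}
    (hx : Transcendental F x) : trdeg F (adjoin F {x}) = 1 := by
  refine (trdeg_adjoin_singleton_le x).antisymm ?_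
  have h : AlgebraicIndependent F fun _ : PUnit => AdjoinSimple.gen F x := by
    rw [algebraicIndependent_unique_type_iff]
    refine fun h => hx ?_
    simpa using h.algHom (adjoin F {x}).val
  exact Cardinal.mk_punit.ge.trans h.cardinalMk_le_trdeg

/-- **Schanuel's conjecture holds iff Schanuel's conjecture over the kernel holds.** -/
theorem sc_iff_sc_over_kernel : SchanuelConjecture ↔ SchanuelOverKernel := by
  have hπ := trdeg_adjoin_singleton transcendental_pi_mul_I
  constructor
  · intro h n a
    set S := Set.range a ∪ Set.range fun i => Complex.exp (a i)
    rw [add_comm, ← hπ, trdeg_adjoin_add_trdeg_adjoin]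
    have hne : (Real.pi : ℂ) * Complex.I ≠ 0 := by simp [Real.pi_ne_zero]
    obtain ⟨B, hBt, -, hspan, hli⟩ := exists_linearIndepOn_id_extension
      (K := ℚ) (LinearIndepOn.singleton (v := id) hne)
      (Set.singleton_subset_iff.2 (Set.mem_insert _ (Set.range a)))
    have hspan' : Submodule.span ℚ (insert ((Real.pi : ℂ) * Complex.I) (Set.range a)) =
        Submodule.span ℚ B :=
      le_antisymm (Submodule.span_le.2 hspan) (Submodule.span_mono hBt)
    rw [hspan', rank_span_set hli]
    have : Finite B := ((Set.finite_range a).insert _).subset hBt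
    obtain ⟨m, ⟨e⟩⟩ := Finite.exists_equiv_fin B
    have hm := h m (fun i => e.symm i) (LinearIndependent.comp hli e.symm e.symm.injective)
    rw [Cardinal.mk_congr e, Cardinal.mk_fin]
    refine hm.trans (trdeg_adjoin_mono ?_)
    have hBmem : ∀ b ∈ B, b ∈ IntermediateField.adjoin ℚ ({(Real.pi : ℂ) * Complex.I} ∪ S) ∧
        Complex.exp b ∈ IntermediateField.adjoin ℚ ({(Real.pi : ℂ) * Complex.I} ∪ S) := by
      intro b hb
      rcases hBt hb with rfl | ⟨i, rfl⟩
      · refine ⟨IntermediateField.subset_adjoin _ _ (Or.inl rfl), ?_⟩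
        rw [Complex.exp_pi_mul_I]
        exact neg_mem (one_mem _)
      · exact ⟨IntermediateField.subset_adjoin _ _ (Or.inr (Or.inl ⟨i, rfl⟩)),
          IntermediateField.subset_adjoin _ _ (Or.inr (Or.inr ⟨i, rfl⟩))⟩
    rintro _ (⟨i, rfl⟩ | ⟨i, rfl⟩)
    · exact (hBmem _ (e.symm i).2).1
    · exact (hBmem _ (e.symm i).2).2
  · intro h n a ha
    have hn := h n a
    set S := Set.range a ∪ Set.range fun i => Complex.exp (a i)
    rw [add_comm, ← hπ, trdeg_adjoin_add_trdeg_adjoin] at hn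
    have hrank : Module.rank ℚ (Submodule.span ℚ (Set.range a)) = n := by
      rw [rank_span ha, Cardinal.mk_range_eq a ha.injective, Cardinal.mk_fin]
    by_cases hmem : (Real.pi : ℂ) * Complex.I ∈ Submodule.span ℚ (Set.range a)
    · rw [Submodule.span_insert_eq_span hmem, hrank] at hn
      refine hn.trans (trdeg_adjoin_mono (Set.union_subset (Set.singleton_subset_iff.2 ?_)
        (IntermediateField.subset_adjoin _ _)))
      have hle : Submodule.span ℚ (Set.range a) ≤
          (IntermediateField.adjoin ℚ S).toSubalgebra.toSubmodule :=
        Submodule.span_le.2 (Set.subset_union_left.trans (IntermediateField.subset_adjoin _ _))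
      exact hle hmem
    · have hrank' : Module.rank ℚ
          (Submodule.span ℚ (insert ((Real.pi : ℂ) * Complex.I) (Set.range a))) = n + 1 := by
        rw [rank_span_set ((LinearIndependent.linearIndepOn_id ha).id_insert hmem),
          Cardinal.mk_insert fun h => hmem (Submodule.subset_span h),
          Cardinal.mk_range_eq a ha.injective, Cardinal.mk_fin]
      rw [hrank', Set.union_comm, ← trdeg_adjoin_add_trdeg_adjoin] at hn
      exact Cardinal.add_one_le_add_one_iff.1
        (hn.trans (add_le_add_right (trdeg_adjoin_singleton_le _) _))
end

section
/- The two-sorted Schanuel conjecture implies the Schanuel conjecture for raising to powers from a field K (SCP_K): if for every n and all complex numbers a₁,…,aₙ one has trdeg_ℚ(a₁,…,aₙ) + trdeg_ℚ(exp a₁,…,exp aₙ) ≥ dim_ℚ span_ℚ{a₁,…,aₙ}, then for every subfield K of ℂ whose transcendence degree over ℚ is a finite number d, and for every n and all complex numbers a₁,…,aₙ, one has dim_K span_K{a₁,…,aₙ} + trdeg_ℚ(exp a₁,…,exp aₙ) + d ≥ dim_ℚ span_ℚ{a₁,…,aₙ}. -/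
set_option maxHeartbeats 1000000
set_option synthInstance.maxHeartbeats 400000

/-- The two-sorted Schanuel conjecture:
`trdeg_ℚ(a₁,…,aₙ) + trdeg_ℚ(exp a₁,…,exp aₙ) ≥ dim_ℚ span_ℚ {a₁,…,aₙ}`. -/
def TwoSortedSchanuel : Prop :=
  ∀ (n : ℕ) (a : Fin n → ℂ),
    Module.rank ℚ (Submodule.span ℚ (Set.range a))
      ≤ trdeg ℚ (IntermediateField.adjoin ℚ (Set.range a))
        + trdeg ℚ (IntermediateField.adjoin ℚ (Set.range fun i => Complex.exp (a i)))

open scoped IntermediateField.algebraAdjoinAdjoin in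
theorem trdeg_adjoin_le_trdeg_algebraAdjoin {F E : Type*} [Field F] [Field E] [Algebra F E]
    (s : Set E) :
    Algebra.trdeg F (IntermediateField.adjoin F s) ≤ Algebra.trdeg F (Algebra.adjoin F s) := by
  have : Algebra.IsAlgebraic (Algebra.adjoin F s) (IntermediateField.adjoin F s) :=
    IsLocalization.isAlgebraic _ (nonZeroDivisors (Algebra.adjoin F s))
  rw [← trdeg_add_eq (R := F) (S := Algebra.adjoin F s) (A := IntermediateField.adjoin F s),
    trdeg_eq_zero (R := Algebra.adjoin F s), add_zero]

theorem trdeg_algebraAdjoin_le_mk {F E : Type*} [Field F] [Field E] [Algebra F E] (s : Set E) :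
    Algebra.trdeg F (Algebra.adjoin F s) ≤ Cardinal.mk s := by
  have h := lift_trdeg_le_of_surjective
    (MvPolynomial.aeval (R := F) ((↑) : s → E)).rangeRestrict
    (MvPolynomial.aeval (R := F) ((↑) : s → E)).rangeRestrict_surjective
  rw [← Algebra.adjoin_range_eq_range_aeval, Subtype.range_coe,
    MvPolynomial.trdeg_of_isDomain] at h
  simpa using h

universe v in
theorem trdeg_adjoin_le_trdeg_add_rank_span {F : Type*} {K E : Type v} [Field F] [Field K]
    [Field E] [Algebra F K] [Algebra K E] [Algebra F E] [IsScalarTower F K E] (s : Set E) :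
    Algebra.trdeg F (IntermediateField.adjoin F s)
      ≤ Algebra.trdeg F K + Module.rank K (Submodule.span K s) := by
  obtain ⟨b, -, hspan, hb⟩ := exists_linearIndependent K s
  have hsub : Algebra.adjoin F s ≤ (Algebra.adjoin K b).restrictScalars F := by
    refine Algebra.adjoin_le fun x hx => ?_
    have hx' : x ∈ Submodule.span K b := hspan ▸ Submodule.subset_span hx
    exact Algebra.span_le_adjoin K b hx'
  calc Algebra.trdeg F (IntermediateField.adjoin F s)
      ≤ Algebra.trdeg F (Algebra.adjoin F s) := trdeg_adjoin_le_trdeg_algebraAdjoin s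
    _ ≤ Algebra.trdeg F (Algebra.adjoin K b) :=
      trdeg_le_of_injective (A' := (Algebra.adjoin K b).restrictScalars F)
        (Subalgebra.inclusion hsub) (Subalgebra.inclusion_injective hsub)
    _ = Algebra.trdeg F K + Algebra.trdeg K (Algebra.adjoin K b) :=
      (trdeg_add_eq (R := F) (S := K) (A := Algebra.adjoin K b)).symm
    _ ≤ Algebra.trdeg F K + Module.rank K (Submodule.span K s) := by
      rw [← hspan, rank_span_set hb]
      gcongr
      exact trdeg_algebraAdjoin_le_mk b

/-- **The two-sorted Schanuel conjecture implies the Schanuel conjecture for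
raising to powers from a field `K` (SCP_K):** for every subfield `K` of `ℂ` of finite
transcendence degree `d` over `ℚ`, and all complex `a₁,…,aₙ`,
`dim_K span_K {a₁,…,aₙ} + trdeg_ℚ(exp a₁,…,exp aₙ) + d ≥ dim_ℚ span_ℚ {a₁,…,aₙ}`. -/
theorem two_sorted_sc_implies_scp_K (h2 : TwoSortedSchanuel) :
    ∀ (K : Subfield ℂ) (d : ℕ), trdeg ℚ K = (d : Cardinal) →
      ∀ (n : ℕ) (a : Fin n → ℂ),
        Module.rank ℚ (Submodule.span ℚ (Set.range a))
          ≤ Module.rank K (Submodule.span K (Set.range a))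
            + trdeg ℚ (IntermediateField.adjoin ℚ
                (Set.range fun i => Complex.exp (a i)))
            + (d : Cardinal) := by
  intro K d hd n a
  have h : trdeg ℚ (IntermediateField.adjoin ℚ (Set.range a))
      ≤ trdeg ℚ K + Module.rank K (Submodule.span K (Set.range a)) :=
    trdeg_adjoin_le_trdeg_add_rank_span (Set.range a)
  rw [hd] at h
  refine (h2 n a).trans ((add_le_add_left h _).trans_eq ?_)
  ring
end

section
/- The Weak Schanuel conjecture implies the Schanuel conjecture for raising to an algebraic power (SCP_alg): suppose that for every N and all complex numbers c₁,…,c_N with trdeg_ℚ(c₁, exp c₁, …, c_N, exp c_N) < N there exist integers m₁,…,m_N, not all zero, such that exp(Σᵢ mᵢ cᵢ) = 1. Then for every algebraic number ρ and all complex numbers a₁, b₁, …, aₙ, bₙ such that each bᵢ is a value of aᵢ^ρ: if trdeg_ℚ(a₁, b₁, …, aₙ, bₙ) < n, then there exist integers m₁,…,m_{2n}, not all zero, such that Πᵢ aᵢ^{mᵢ} · Πᵢ bᵢ^{m_{n+i}} = 1. -/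
set_option maxHeartbeats 1000000
set_option synthInstance.maxHeartbeats 400000

/-- The weak Schanuel conjecture: whenever
`trdeg_ℚ(c₁, exp c₁, …, c_N, exp c_N) < N` there are integers `mᵢ`, not all zero,
with `exp (∑ mᵢ cᵢ) = 1`. -/
def WeakSchanuel : Prop :=
  ∀ (N : ℕ) (c : Fin N → ℂ),
    trdeg ℚ (IntermediateField.adjoin ℚ
        (Set.range c ∪ Set.range fun i => Complex.exp (c i))) < (N : Cardinal) →
    ∃ m : Fin N → ℤ, m ≠ 0 ∧ Complex.exp (∑ i, m i • c i) = 1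

open Cardinal IntermediateField.algebraAdjoinAdjoin in
/-- A field generated over `F` by a set `s` has transcendence degree at most `#s`. -/
lemma IntermediateField.trdeg_adjoin_le {F E : Type*} [Field F] [Field E] [Algebra F E]
    (s : Set E) : Algebra.trdeg F (IntermediateField.adjoin F s) ≤ #s := by
  have hs : Algebra.trdeg F (Algebra.adjoin F s) ≤ #s := by
    have hr : (MvPolynomial.aeval (R := F) ((↑) : s → E)).range = Algebra.adjoin F s := by
      rw [← Algebra.adjoin_range_eq_range_aeval, Subtype.range_coe]
    rw [← hr]
    have := lift_trdeg_le_of_surjective (MvPolynomial.aeval (R := F) ((↑) : s → E)).rangeRestrict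
      (AlgHom.rangeRestrict_surjective _)
    simpa using this
  rwa [← trdeg_add_eq F (Algebra.adjoin F s) (A := IntermediateField.adjoin F s),
    trdeg_eq_zero (R := Algebra.adjoin F s), add_zero]

open Cardinal in
/-- If every element of `L` is algebraic over the field generated by `s` over `K`, then
`trdeg_F L ≤ trdeg_F K + #s`. -/
lemma IntermediateField.trdeg_le_add_of_isAlgebraic_adjoin {F E : Type*} [Field F] [Field E]
    [Algebra F E] (K L : IntermediateField F E) (s : Set E)
    (h : ∀ x ∈ L, IsAlgebraic (IntermediateField.adjoin K s) x) :
    Algebra.trdeg F L ≤ Algebra.trdeg F K + #s := by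
  let T := IntermediateField.adjoin K s
  have : IsScalarTower F T E := .of_algebraMap_eq fun _ => rfl
  let M := algebraicClosure T E
  let f : L →ₐ[F] M :=
    { toFun := fun x => ⟨x, mem_algebraicClosure_iff.2 (h x x.2)⟩
      map_one' := rfl
      map_mul' := fun _ _ => rfl
      map_zero' := rfl
      map_add' := fun _ _ => rfl
      commutes' := fun _ => rfl }
  have hf : Function.Injective f := fun x y hxy =>
    Subtype.ext (congrArg (fun z : M => (z : E)) hxy)
  have h₁ : Algebra.trdeg F T + Algebra.trdeg T M = Algebra.trdeg F M := trdeg_add_eq F T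
  have h₂ : Algebra.trdeg F K + Algebra.trdeg K T = Algebra.trdeg F T := trdeg_add_eq F K
  rw [trdeg_eq_zero (R := T), add_zero] at h₁
  calc Algebra.trdeg F L ≤ Algebra.trdeg F M := trdeg_le_of_injective f hf
    _ = Algebra.trdeg F K + Algebra.trdeg K T := by rw [← h₁, h₂]
    _ ≤ _ := by gcongr; exact IntermediateField.trdeg_adjoin_le s

/-- **The weak Schanuel conjecture implies the Schanuel conjecture for raising to an
algebraic power (SCP_alg):** for every algebraic `ρ` and complex numbers `aᵢ, bᵢ` with
`bᵢ` a value of `aᵢ^ρ`, if `trdeg_ℚ(a₁, b₁, …, aₙ, bₙ) < n` then there are integers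
`m₁,…,m_{2n}`, not all zero, with `∏ aᵢ^{mᵢ} ⬝ ∏ bᵢ^{m_{n+i}} = 1`. -/
theorem weak_sc_implies_scp_alg (h : WeakSchanuel)
    (ρ : ℂ) (hρ : IsAlgebraic ℚ ρ) (n : ℕ) (a b : Fin n → ℂ)
    (hpow : ∀ i, ∃ α : ℂ, Complex.exp α = a i ∧ Complex.exp (ρ * α) = b i)
    (htd : trdeg ℚ (IntermediateField.adjoin ℚ (Set.range a ∪ Set.range b))
      < (n : Cardinal)) :
    ∃ m m' : Fin n → ℤ, (m ≠ 0 ∨ m' ≠ 0) ∧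
      (∏ i, a i ^ m i) * (∏ i, b i ^ m' i) = 1 := by
  choose α hα hβ using hpow
  set K := IntermediateField.adjoin ℚ (Set.range a ∪ Set.range b)
  let c : Fin (n + n) → ℂ := Fin.append α fun i => ρ * α i
  have hadj : ∀ x ∈ IntermediateField.adjoin ℚ
      (Set.range c ∪ Set.range fun i => Complex.exp (c i)),
      IsAlgebraic (IntermediateField.adjoin K (Set.range α)) x := by
    set T := IntermediateField.adjoin K (Set.range α)
    have hαT (i) : IsAlgebraic T (α i) :=
      isAlgebraic_algebraMap (⟨α i, IntermediateField.subset_adjoin _ _ ⟨i, rfl⟩⟩ : T)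
    have hKT (x : ℂ) (hx : x ∈ K) : IsAlgebraic T x :=
      isAlgebraic_algebraMap (algebraMap K T ⟨x, hx⟩)
    suffices hle : IntermediateField.adjoin ℚ
        (Set.range c ∪ Set.range fun i => Complex.exp (c i)) ≤
        (algebraicClosure T ℂ).restrictScalars ℚ from
      fun x hx => mem_algebraicClosure_iff.1 (hle hx)
    rw [IntermediateField.adjoin_le_iff]
    rintro _ (⟨i, rfl⟩ | ⟨i, rfl⟩) <;> refine mem_algebraicClosure_iff.2 ?_ <;>
      refine Fin.addCases (fun j => ?_) (fun j => ?_) i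
    · simpa [-Fin.natAdd_eq_addNat, c] using hαT j
    · simpa [-Fin.natAdd_eq_addNat, c] using (hρ.tower_top T).mul (hαT j)
    · simpa [-Fin.natAdd_eq_addNat, c, hα] using
        hKT _ (IntermediateField.subset_adjoin _ _ (.inl ⟨j, rfl⟩))
    · simpa [-Fin.natAdd_eq_addNat, c, hβ] using
        hKT _ (IntermediateField.subset_adjoin _ _ (.inr ⟨j, rfl⟩))
  obtain ⟨m, hm, hexp⟩ := h (n + n) c <| by
    refine (IntermediateField.trdeg_le_add_of_isAlgebraic_adjoin K _ _ hadj).trans_lt ?_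
    have hcard : Cardinal.mk (Set.range α) ≤ n := by simpa using Cardinal.mk_range_le (f := α)
    rw [Nat.cast_add]
    exact (add_le_add_right hcard _).trans_lt
      ((Cardinal.add_lt_add_iff_of_right_lt_aleph0 (Cardinal.natCast_lt_aleph0)).2 htd)
  refine ⟨fun i => m (Fin.castAdd n i), fun i => m (Fin.natAdd n i), ?_, ?_⟩
  · by_contra! h0
    exact hm (funext (Fin.addCases (congrFun h0.1) (congrFun h0.2)))
  · simpa [-Fin.natAdd_eq_addNat, c, Fin.sum_univ_add, Complex.exp_add, Complex.exp_sum,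
      Complex.exp_int_mul, hα, hβ] using hexp
end

section
/- (Gelfond–Schneider theorem). Let a, ρ ∈ ℂ be algebraic numbers with a ≠ 0, a ≠ 1, and ρ irrational (ρ ∉ ℚ). Let α ∈ ℂ satisfy exp α = a. Then exp(ρ·α) is transcendental over ℚ. -/
open NumberField

/-- **Siegel's lemma** over the ring of integers of a number field, for systems with twice as many
unknowns as equations. The constant depends only on `K`. -/
lemma exists_siegel_const (K : Type*) [Field K] [NumberField K] :
    ∃ C : ℝ, ∀ {ι κ : Type} [Fintype ι] [Fintype κ] (p : ℕ) (A : ℝ) (M : Matrix ι κ (𝓞 K)),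
      M ≠ 0 → 0 < p → Fintype.card ι = p → Fintype.card κ = 2 * p →
      (∀ k l, house (M k l : K) ≤ A) →
      ∃ ξ : κ → 𝓞 K, ξ ≠ 0 ∧ M.mulVec ξ = 0 ∧ ∀ l, house (ξ l : K) ≤ C * (2 * p) * A := by
  classical
  have key : ∃ c : ℝ, ∀ {ι κ : Type} [Fintype ι] [Fintype κ] (p q : ℕ) (A : ℝ)
      (M : Matrix ι κ (𝓞 K)), M ≠ 0 → 0 < p → p < q → Fintype.card ι = p → Fintype.card κ = q →
      (∀ k l, house (M k l : K) ≤ A) → ∃ ξ : κ → 𝓞 K, ξ ≠ 0 ∧ M.mulVec ξ = 0 ∧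
        ∀ l, house (ξ l : K) ≤ c * ((c * q * A) ^ ((p : ℝ) / (q - p))) :=
    ⟨_, fun p q A M hM hp hpq hι hκ hA =>
      house.exists_ne_zero_int_vec_house_le K M hM hp hpq hκ hA hι⟩
  obtain ⟨c, hc⟩ := key
  refine ⟨c ^ 2, fun p A M hM hp hι hκ hA => ?_⟩
  obtain ⟨ξ, h0, h1, h2⟩ := hc p (2 * p) A M hM hp (by omega) hι hκ hA
  refine ⟨ξ, h0, h1, fun l => (h2 l).trans_eq ?_⟩
  have hp' : (p : ℝ) ≠ 0 := by positivity
  have : (p : ℝ) / (((2 * p : ℕ) : ℝ) - p) = 1 := by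
    push_cast; rw [show (2 * p - p : ℝ) = p by ring, div_self hp']
  rw [this, Real.rpow_one]
  push_cast; ring

lemma Differentiable.exists_eq_prod_sub_mul {F : ℂ → ℂ} (hF : Differentiable ℂ F) (Z : Finset ℂ)
    (hZ : ∀ z ∈ Z, F z = 0) :
    ∃ G : ℂ → ℂ, Differentiable ℂ G ∧ ∀ z, F z = (∏ x ∈ Z, (z - x)) * G z := by
  induction Z using Finset.induction_on with
  | empty => exact ⟨F, hF, by simp⟩
  | insert x Z hx ih =>
    obtain ⟨G, hG, hFG⟩ := ih fun z hz => hZ z (Finset.mem_insert_of_mem hz)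
    have hGx : G x = 0 := by
      have h := hFG x
      rw [hZ x (Finset.mem_insert_self x Z), eq_comm, mul_eq_zero, Finset.prod_eq_zero_iff] at h
      refine h.resolve_left ?_
      rintro ⟨y, hy, hxy⟩
      exact hx (sub_eq_zero.mp hxy ▸ hy)
    refine ⟨dslope G x, ?_, fun z => ?_⟩
    · rw [← differentiableOn_univ, Complex.differentiableOn_dslope Filter.univ_mem]
      exact hG.differentiableOn
    · have := sub_smul_dslope G x z
      rw [hGx, sub_zero, smul_eq_mul] at this
      rw [Finset.prod_insert hx, hFG, ← this]; ring

/-- A **Schwarz lemma** for an entire function with many zeros in a disk. -/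
lemma norm_le_div_two_pow_of_zeros {F : ℂ → ℂ} (hF : Differentiable ℂ F) {Z : Finset ℂ}
    {r C : ℝ} (hr : 0 < r) (hZ : ∀ z ∈ Z, F z = 0) (hZr : ∀ z ∈ Z, ‖z‖ ≤ r)
    (hC : ∀ z, ‖z‖ ≤ 5 * r → ‖F z‖ ≤ C) {w : ℂ} (hw : ‖w‖ ≤ r) :
    ‖F w‖ ≤ C / 2 ^ Z.card := by
  obtain ⟨G, hG, hFG⟩ := hF.exists_eq_prod_sub_mul Z hZ
  have hGw : ‖G w‖ ≤ C / (4 * r) ^ Z.card := by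
    refine Complex.norm_le_of_forall_mem_frontier_norm_le (U := Metric.ball 0 (5 * r))
      Metric.isBounded_ball hG.diffContOnCl (fun z hz => ?_) (subset_closure ?_)
    · rw [frontier_ball _ (by positivity), mem_sphere_zero_iff_norm] at hz
      rw [le_div_iff₀ (by positivity), mul_comm]
      refine le_trans ?_ (hC z hz.le)
      rw [hFG, norm_mul, norm_prod]
      gcongr
      rw [← Finset.prod_const]
      refine Finset.prod_le_prod (fun _ _ => by positivity) fun x hx => ?_
      have := norm_sub_norm_le z x
      linarith [hZr x hx]
    · rw [mem_ball_zero_iff]; linarith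
  calc ‖F w‖ = (∏ x ∈ Z, ‖w - x‖) * ‖G w‖ := by rw [hFG, norm_mul, norm_prod]
    _ ≤ (2 * r) ^ Z.card * (C / (4 * r) ^ Z.card) := by
      gcongr
      rw [← Finset.prod_const]
      refine Finset.prod_le_prod (fun _ _ => norm_nonneg _) fun x hx => ?_
      linarith [norm_sub_le w x, hZr x hx]
    _ = C / 2 ^ Z.card := by
      rw [show 4 * r = 2 * (2 * r) by ring, mul_pow 2 (2 * r)]
      field_simp

lemma exists_mul_pow_le_two_pow_sq (B D : ℕ) :
    ∃ N : ℕ, 0 < N ∧ ∀ M : ℕ, N ^ 2 ≤ M → (B * M) ^ (D * N * M) ≤ 2 ^ M ^ 2 := by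
  have h : ∀ᶠ m : ℕ in Filter.atTop, (4 * B * m ^ 2) ^ D ≤ 2 ^ m := by
    have ht := (tendsto_pow_const_div_const_pow_of_one_lt (2 * D) (one_lt_two (α := ℝ))).const_mul
      ((4 * B : ℝ) ^ D)
    rw [mul_zero] at ht
    filter_upwards [ht.eventually_le_const one_pos] with m hm
    rw [mul_div_assoc', div_le_one (by positivity), pow_mul, ← mul_pow] at hm
    exact_mod_cast hm
  obtain ⟨N, hN⟩ := Filter.eventually_atTop.mp h
  refine ⟨N + 1, N.succ_pos, fun M hM => ?_⟩
  have h1 : N + 1 ≤ M.sqrt := Nat.le_sqrt'.mpr hM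
  set m := M.sqrt
  have h2 : M ≤ 4 * m ^ 2 := by
    have := Nat.lt_succ_sqrt' M
    change M < (m + 1) ^ 2 at this
    nlinarith
  have hM0 : 0 < M := lt_of_lt_of_le (by positivity) hM
  rcases Nat.eq_zero_or_pos B with rfl | hB
  · rcases Nat.eq_zero_or_pos (D * (N + 1) * M) with h | h
    · rw [h]; simpa using Nat.one_le_two_pow
    · rw [zero_mul, zero_pow h.ne']; positivity
  calc (B * M) ^ (D * (N + 1) * M) ≤ (B * M) ^ (D * m * M) := by
        gcongr
        exact Nat.mul_pos hB hM0
    _ = (((B * M) ^ D) ^ m) ^ M := by rw [pow_mul, pow_mul]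
    _ ≤ (((4 * B * m ^ 2) ^ D) ^ m) ^ M := by
        gcongr ((?_ ^ D) ^ m) ^ M
        nlinarith
    _ ≤ ((2 ^ m) ^ m) ^ M := by
        exact Nat.pow_le_pow_left (Nat.pow_le_pow_left (hN m (by omega)) m) M
    _ = (2 ^ (m ^ 2)) ^ M := by rw [← pow_mul 2, ← sq]
    _ ≤ (2 ^ M) ^ M := by
        gcongr
        · norm_num
        · exact Nat.sqrt_le' M
    _ = 2 ^ M ^ 2 := by rw [← pow_mul, sq]

/-- The exponential polynomial `∑ c (i, j) * z ^ i * exp (j * α * z)`. -/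
noncomputable def expPoly {m n : ℕ} (c : Fin m × Fin n → ℂ) (α z : ℂ) : ℂ :=
  ∑ l, c l * z ^ (l.1 : ℕ) * Complex.exp (α * z) ^ (l.2 : ℕ)

lemma differentiable_expPoly {m n : ℕ} (c : Fin m × Fin n → ℂ) (α : ℂ) :
    Differentiable ℂ (expPoly c α) := by
  unfold expPoly
  fun_prop

lemma norm_expPoly_le {m n : ℕ} {c : Fin m × Fin n → ℂ} {α z : ℂ} {C R : ℝ}
    (hc : ∀ l, ‖c l‖ ≤ C) (hC : 0 ≤ C) (hR : 1 ≤ R) (hz : ‖z‖ ≤ R) :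
    ‖expPoly c α z‖ ≤ m * n * (C * R ^ m * Real.exp (‖α‖ * R) ^ n) := by
  have hE : 1 ≤ Real.exp (‖α‖ * R) := Real.one_le_exp (by positivity)
  have : ∀ l ∈ Finset.univ, ‖c l * z ^ (l.1 : ℕ) * Complex.exp (α * z) ^ (l.2 : ℕ)‖ ≤
      C * R ^ m * Real.exp (‖α‖ * R) ^ n := fun l _ => by
    rw [norm_mul, norm_mul, norm_pow, norm_pow]
    have h1 : ‖z‖ ^ (l.1 : ℕ) ≤ R ^ m :=
      (pow_le_pow_left₀ (norm_nonneg z) hz _).trans (pow_le_pow_right₀ hR l.1.2.le)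
    have h2 : ‖Complex.exp (α * z)‖ ^ (l.2 : ℕ) ≤ Real.exp (‖α‖ * R) ^ n := by
      refine (pow_le_pow_left₀ (norm_nonneg _) ?_ _).trans (pow_le_pow_right₀ hE l.2.2.le)
      refine (Complex.norm_exp_le_exp_norm _).trans (Real.exp_le_exp.mpr ?_)
      rw [norm_mul]
      gcongr
    gcongr
    exact hc l
  refine (norm_sum_le_of_le _ this).trans_eq ?_
  simp [mul_assoc]

lemma eq_zero_of_sum_mul_pow_eq_zero {n : ℕ} {v : Fin n → ℂ} {s : Set ℂ} (hs : s.Infinite)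
    (h : ∀ z ∈ s, ∑ i, v i * z ^ (i : ℕ) = 0) : v = 0 := by
  have hp : (∑ i, Polynomial.C (v i) * Polynomial.X ^ (i : ℕ)) = 0 :=
    Polynomial.eq_zero_of_infinite_isRoot _ (hs.mono fun z hz => by
      simpa [Polynomial.eval_finsetSum] using h z hz)
  ext i
  have := congrArg (fun p => Polynomial.coeff p i) hp
  simpa [Polynomial.finsetSum_coeff, Polynomial.coeff_X_pow, Fin.val_inj] using this

lemma eq_zero_of_expPoly_eq_zero {m n : ℕ} {c : Fin m × Fin n → ℂ} {α : ℂ} (hα : α ≠ 0)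
    (h : ∀ z, expPoly c α z = 0) : c = 0 := by
  have key : ∀ y : ℂ, y ≠ 0 → ∀ i, ∑ j, c (i, j) * y ^ (j : ℕ) = 0 := fun y hy => by
    refine congrFun (eq_zero_of_sum_mul_pow_eq_zero
      (s := Set.range fun k : ℕ => (Complex.log y + k * (2 * Real.pi * Complex.I)) / α)
      (Set.infinite_range_of_injective fun k l hkl => ?_) ?_)
    · have := (div_left_inj' hα).mp hkl
      have := mul_right_cancel₀ Complex.two_pi_I_ne_zero (add_left_cancel this)
      exact_mod_cast this
    · rintro _ ⟨k, rfl⟩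
      have := h ((Complex.log y + k * (2 * Real.pi * Complex.I)) / α)
      rw [expPoly, Fintype.sum_prod_type, mul_div_cancel₀ _ hα, Complex.exp_add,
        Complex.exp_nat_mul_two_pi_mul_I, mul_one, Complex.exp_log hy] at this
      rw [← this]
      refine Finset.sum_congr rfl fun i _ => ?_
      rw [Finset.sum_mul]
      exact Finset.sum_congr rfl fun j _ => by ring
  ext ⟨i, j⟩
  exact congrFun (eq_zero_of_sum_mul_pow_eq_zero (v := fun j => c (i, j))
    (Set.infinite_of_finite_compl (s := {0}ᶜ) (by simp)) fun y hy => key y hy i) j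

/-- The elementary inequalities relating `N`, `M` and `B` used at every level `M ≥ N ^ 2`. -/
lemma level_bounds {B : ℝ} (hB : 1 ≤ B) {N M : ℕ} (hN : 0 < N) (hM : N ^ 2 ≤ M) :
    1 ≤ 2 * B * M ∧ 0 < M ∧ N ^ 3 ≤ N * M ∧ 0 < N * M := by
  have hM0 : 0 < M := lt_of_lt_of_le (by positivity) hM
  have : (1 : ℝ) ≤ M := by exact_mod_cast hM0
  exact ⟨by nlinarith, hM0, by nlinarith, by positivity⟩

lemma card_le_level {B : ℝ} (hB : 1 ≤ B) {N M : ℕ} (hN : 0 < N) (hM : N ^ 2 ≤ M) :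
    (((2 * N ^ 3 : ℕ) : ℝ) * (N : ℕ)) ≤ (2 * B * M) ^ (2 * (N * M)) := by
  obtain ⟨h1, h2, h3, h4⟩ := level_bounds hB hN hM
  have hM' : (N : ℝ) ^ 2 ≤ M := by exact_mod_cast hM
  calc (((2 * N ^ 3 : ℕ) : ℝ) * (N : ℕ)) = 2 * (N ^ 2) ^ 2 := by push_cast; ring
    _ ≤ 2 * M ^ 2 := by gcongr
    _ ≤ (2 * 1 * M) ^ 2 := by nlinarith [sq_nonneg (M : ℝ)]
    _ ≤ (2 * B * M) ^ 2 := by gcongr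
    _ ≤ _ := pow_le_pow_right₀ h1 (by omega)

lemma coeff_bound_le_level {B : ℝ} (hB : 1 ≤ B) {N M : ℕ} (hN : 0 < N) (hM : N ^ 2 ≤ M) :
    B * (2 * N ^ 4) * (2 * B * N ^ 2) ^ (8 * N ^ 3) ≤ (2 * B * M) ^ (10 * (N * M)) := by
  obtain ⟨h1, h2, h3, h4⟩ := level_bounds hB hN hM
  have hM' : (N : ℝ) ^ 2 ≤ M := by exact_mod_cast hM
  have hN4 : (N : ℝ) ^ 4 ≤ (M : ℝ) ^ 2 := by
    calc (N : ℝ) ^ 4 = (N ^ 2) ^ 2 := by ring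
      _ ≤ (M : ℝ) ^ 2 := by gcongr
  calc B * (2 * N ^ 4) * (2 * B * N ^ 2) ^ (8 * N ^ 3)
      ≤ (2 * B * M) ^ 2 * (2 * B * M) ^ (8 * (N * M)) := by
        gcongr ?_ * ?_
        · nlinarith [mul_le_mul_of_nonneg_left hN4 (by positivity : (0 : ℝ) ≤ 2 * B),
            mul_le_mul_of_nonneg_right hB (by positivity : (0 : ℝ) ≤ B * M ^ 2),
            (by positivity : (0 : ℝ) ≤ B * B * M ^ 2)]
        · exact (pow_le_pow_left₀ (by positivity) (by gcongr) _).trans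
            (pow_le_pow_right₀ h1 (by omega))
    _ = (2 * B * M) ^ (2 + 8 * (N * M)) := by rw [pow_add]
    _ ≤ _ := pow_le_pow_right₀ h1 (by omega)

/-- Growth of an exponential polynomial with small coefficients on a disk of radius comparable
to `M`. -/
lemma norm_expPoly_le_level {B β : ℝ} (hB : 1 ≤ B) {N M : ℕ} (hN : 0 < N) (hM : N ^ 2 ≤ M)
    {c : Fin (2 * N ^ 3) × Fin N → ℂ} {α z : ℂ}
    (hc : ∀ l, ‖c l‖ ≤ (2 * B * M) ^ (10 * (N * M))) (hβ : 1 ≤ β) (hβB : 5 * β ≤ B)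
    (hαB : Real.exp (‖α‖ * (5 * β)) ≤ B) (hz : ‖z‖ ≤ 5 * (β * M)) :
    ‖expPoly c α z‖ ≤ (2 * B * M) ^ (20 * (N * M)) := by
  obtain ⟨h1, h2, h3, h4⟩ := level_bounds hB hN hM
  have hM1 : (1 : ℝ) ≤ M := by exact_mod_cast h2
  refine (norm_expPoly_le hc (by positivity) (by nlinarith) hz).trans ?_
  have e1 : (5 * (β * M)) ^ (2 * N ^ 3) ≤ (2 * B * M) ^ (2 * (N * M)) := by
    refine (pow_le_pow_left₀ (by positivity) ?_ _).trans (pow_le_pow_right₀ h1 (by omega))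
    nlinarith
  have e2 : Real.exp (‖α‖ * (5 * (β * M))) ^ N ≤ (2 * B * M) ^ (N * M) := by
    rw [show ‖α‖ * (5 * (β * M)) = M * (‖α‖ * (5 * β)) by ring, Real.exp_nat_mul, ← pow_mul,
      mul_comm M N]
    refine pow_le_pow_left₀ (by positivity) (hαB.trans ?_) _
    nlinarith
  calc _ ≤ (2 * B * M) ^ (2 * (N * M)) * ((2 * B * M) ^ (10 * (N * M)) *
        (2 * B * M) ^ (2 * (N * M)) * (2 * B * M) ^ (N * M)) := by
        gcongr
        exact card_le_level hB hN hM
    _ = (2 * B * M) ^ (15 * (N * M)) := by ring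
    _ ≤ _ := pow_le_pow_right₀ h1 (by omega)

variable {K : Type*} [Field K]

lemma IsIntegral.intCast_pow_mul_pow {T : ℤ} {x : K} (h : IsIntegral ℤ ((T : K) * x)) {k n : ℕ}
    (hk : k ≤ n) : IsIntegral ℤ ((T : K) ^ n * x ^ k) := by
  obtain ⟨e, rfl⟩ := Nat.exists_eq_add_of_le hk
  rw [show (T : K) ^ (k + e) * x ^ k = T ^ e * (T * x) ^ k by ring]
  exact (isIntegral_algebraMap (R := ℤ) (x := T) |>.pow e).mul (h.pow k)

lemma isIntegral_scaled {T : ℤ} {ρ a b : K} (hρ : IsIntegral ℤ ((T : K) * ρ))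
    (ha : IsIntegral ℤ ((T : K) * a)) (hb : IsIntegral ℤ ((T : K) * b)) {m n M i j s t : ℕ}
    (hi : i ≤ m) (hj : j ≤ n) (hs : s ≤ M) (ht : t ≤ M) :
    IsIntegral ℤ ((T : K) ^ (m + 2 * (M * n)) * ((s + t * ρ) ^ i * (a ^ s * b ^ t) ^ j)) := by
  have hst : IsIntegral ℤ ((T : K) * (s + t * ρ)) := by
    rw [show (T : K) * (s + t * ρ) = algebraMap ℤ K (T * s) + algebraMap ℤ K t * (T * ρ) by
      simp; ring]
    exact isIntegral_algebraMap.add (isIntegral_algebraMap.mul hρ)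
  have h1 := hst.intCast_pow_mul_pow hi
  have h2 := ha.intCast_pow_mul_pow (Nat.mul_le_mul hs hj)
  have h3 := hb.intCast_pow_mul_pow (Nat.mul_le_mul ht hj)
  rw [show (T : K) ^ (m + 2 * (M * n)) * ((s + t * ρ) ^ i * (a ^ s * b ^ t) ^ j) =
    T ^ m * (s + t * ρ) ^ i * (T ^ (M * n) * a ^ (s * j)) * (T ^ (M * n) * b ^ (t * j)) by ring]
  exact (h1.mul h2).mul h3

variable [NumberField K]

lemma house_pow_le_pow {x : K} {B : ℝ} (h : house x ≤ B) (hB : 1 ≤ B) {k n : ℕ} (hk : k ≤ n) :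
    house (x ^ k) ≤ B ^ n :=
  (house_pow_le x k).trans
    ((pow_le_pow_left₀ (house_nonneg x) h k).trans (pow_le_pow_right₀ hB hk))

lemma house_scaled_le {T : ℤ} {ρ a b : K} {B : ℝ} (hB : 1 ≤ B) (hT : house (T : K) ≤ B)
    (hρ : house ρ ≤ B) (ha : house a ≤ B) (hb : house b ≤ B) {m n M i j s t : ℕ}
    (hM : 0 < M) (hi : i ≤ m) (hj : j ≤ n) (hs : s ≤ M) (ht : t ≤ M) :
    house ((T : K) ^ (m + 2 * (M * n)) * ((s + t * ρ) ^ i * (a ^ s * b ^ t) ^ j)) ≤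
      (2 * B * M) ^ (2 * m + 4 * (M * n)) := by
  have hM' : (1 : ℝ) ≤ M := by exact_mod_cast hM
  have hBX : B ≤ 2 * B * M := by nlinarith
  have hX : 1 ≤ 2 * B * M := hB.trans hBX
  have hst : house ((s : K) + t * ρ) ≤ 2 * B * M := by
    have hs' : (s : ℝ) ≤ M := by exact_mod_cast hs
    have ht' : (t : ℝ) ≤ M := by exact_mod_cast ht
    have h1 : house (s : K) = s := by
      have := house_intCast (K := K) s
      simpa using this
    refine (house_add_le _ _).trans ?_
    rw [house_nat_mul, h1]
    have : (t : ℝ) * house ρ ≤ M * B := by gcongr; exact house_nonneg ρ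
    nlinarith
  have e : (T : K) ^ (m + 2 * (M * n)) * ((s + t * ρ) ^ i * (a ^ s * b ^ t) ^ j) =
      T ^ (m + 2 * (M * n)) * ((s + t * ρ) ^ i * (a ^ (s * j) * b ^ (t * j))) := by
    rw [mul_pow, pow_mul, pow_mul]
  have h0 := house_pow_le_pow (hT.trans hBX) hX (le_refl (m + 2 * (M * n)))
  have h1 := house_pow_le_pow hst hX hi
  have h2 := house_pow_le_pow (ha.trans hBX) hX (Nat.mul_le_mul hs hj)
  have h3 := house_pow_le_pow (hb.trans hBX) hX (Nat.mul_le_mul ht hj)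
  rw [e]
  calc _ ≤ house ((T : K) ^ (m + 2 * (M * n))) * (house (((s : K) + t * ρ) ^ i) *
        (house (a ^ (s * j)) * house (b ^ (t * j)))) := by
        refine (house_mul_le _ _).trans (mul_le_mul_of_nonneg_left ?_ (house_nonneg _))
        refine (house_mul_le _ _).trans (mul_le_mul_of_nonneg_left ?_ (house_nonneg _))
        exact house_mul_le _ _
    _ ≤ (2 * B * M) ^ (m + 2 * (M * n)) * ((2 * B * M) ^ m *
        ((2 * B * M) ^ (M * n) * (2 * B * M) ^ (M * n))) := by
        gcongr <;> simp only [house_nonneg, mul_nonneg]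
    _ = _ := by ring

/-- **Liouville's inequality** for nonzero algebraic integers. -/
lemma one_le_norm_mul_house_pow (φ : K →+* ℂ) {x : K} (hx : IsIntegral ℤ x) (h0 : x ≠ 0) :
    1 ≤ ‖φ x‖ * house x ^ (Module.finrank ℚ K - 1) := by
  refine le_trans ?_ (norm_norm_le_norm_mul_house_pow x φ)
  obtain ⟨y, hy⟩ := IsIntegrallyClosed.isIntegral_iff.mp (Algebra.isIntegral_norm ℚ hx)
  have hy0 : y ≠ 0 := by
    rintro rfl
    exact h0 (Algebra.norm_eq_zero_iff.mp (by rw [← hy]; simp))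
  have h1 : (1 : ℝ) ≤ |(y : ℝ)| := by exact_mod_cast Int.one_le_abs hy0
  rw [← hy]
  simpa [Int.norm_eq_abs] using h1

lemma expPoly_add_mul_eq {m n : ℕ} (φ : K →+* ℂ) (ξ : Fin m × Fin n → K) {ρ a b : K} {α : ℂ}
    (ha : Complex.exp α = φ a) (hb : Complex.exp (α * φ ρ) = φ b) (s t : ℕ) :
    expPoly (fun l => φ (ξ l)) α (s + t * φ ρ) =
      φ (∑ l, ξ l * ((s + t * ρ) ^ (l.1 : ℕ) * (a ^ s * b ^ t) ^ (l.2 : ℕ))) := by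
  have h : Complex.exp (α * (s + t * φ ρ)) = φ (a ^ s * b ^ t) := by
    rw [map_mul, map_pow, map_pow, ← ha, ← hb, ← Complex.exp_nat_mul, ← Complex.exp_nat_mul,
      ← Complex.exp_add]
    congr 1; ring
  simp only [expPoly, h, map_sum, map_mul, map_pow, map_add, map_natCast, mul_assoc]

lemma card_image_add_mul {ρ : ℂ} (hρ : ∀ q : ℚ, (q : ℂ) ≠ ρ) (M : ℕ) :
    ((Finset.range M ×ˢ Finset.range M).image fun p : ℕ × ℕ => (p.1 : ℂ) + p.2 * ρ).card =
      M ^ 2 := by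
  rw [Finset.card_image_of_injective, Finset.card_product, Finset.card_range, sq]
  rintro ⟨s, t⟩ ⟨s', t'⟩ h
  simp only at h
  have htt : t = t' := by
    by_contra hne
    have hne' : (t : ℂ) - t' ≠ 0 := sub_ne_zero.mpr (by exact_mod_cast hne)
    refine hρ ((s' - s) / (t - t')) ?_
    push_cast
    rw [div_eq_iff hne']
    linear_combination -h
  subst htt
  simpa using h

/-- Small algebraic integers, not all zero, such that the exponential polynomial with these
coefficients vanishes at the points `s + t * ρ` with `s, t < N ^ 2`. -/
lemma exists_auxiliary_coeffs {T : ℤ} {ρ a b : K} {B C : ℝ} (hB : 1 ≤ B)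
    (hC : ∀ {ι κ : Type} [Fintype ι] [Fintype κ] (p : ℕ) (A : ℝ) (M : Matrix ι κ (𝓞 K)),
      M ≠ 0 → 0 < p → Fintype.card ι = p → Fintype.card κ = 2 * p →
      (∀ k l, house (M k l : K) ≤ A) →
      ∃ ξ : κ → 𝓞 K, ξ ≠ 0 ∧ M.mulVec ξ = 0 ∧ ∀ l, house (ξ l : K) ≤ C * (2 * p) * A)
    (hCB : C ≤ B) (hT0 : T ≠ 0)
    (hρi : IsIntegral ℤ ((T : K) * ρ)) (hai : IsIntegral ℤ ((T : K) * a))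
    (hbi : IsIntegral ℤ ((T : K) * b)) (hT : house (T : K) ≤ B)
    (hρ : house ρ ≤ B) (ha : house a ≤ B) (hb : house b ≤ B) {N : ℕ} (hN : 0 < N) :
    ∃ ξ : Fin (2 * N ^ 3) × Fin N → 𝓞 K, ξ ≠ 0 ∧
      (∀ s < N ^ 2, ∀ t < N ^ 2, ∑ l, (ξ l : K) *
        (((s : K) + t * ρ) ^ (l.1 : ℕ) * (a ^ s * b ^ t) ^ (l.2 : ℕ)) = 0) ∧
      ∀ l, house (ξ l : K) ≤ B * (2 * N ^ 4) * (2 * B * N ^ 2) ^ (8 * N ^ 3) := by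
  let A : Matrix (Fin (N ^ 2) × Fin (N ^ 2)) (Fin (2 * N ^ 3) × Fin N) (𝓞 K) := fun k l =>
    ⟨_, isIntegral_scaled hρi hai hbi l.1.2.le l.2.2.le k.1.2.le k.2.2.le⟩
  have hA0 : A ≠ 0 := fun h => by
    have h1 := congrArg (algebraMap (𝓞 K) K)
      (congrFun (congrFun h (⟨0, by positivity⟩, ⟨0, by positivity⟩)) (⟨0, by positivity⟩, ⟨0, hN⟩))
    have h2 : (T : K) ^ (2 * N ^ 3 + 2 * (N ^ 2 * N)) *
      ((((0 : ℕ) : K) + (0 : ℕ) * ρ) ^ 0 * (a ^ 0 * b ^ 0) ^ 0) = 0 := h1.trans (by simp)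
    simp [hT0] at h2
  have hAb : ∀ k l, house (A k l : K) ≤ (2 * B * N ^ 2) ^ (8 * N ^ 3) := fun k l => by
    refine (house_scaled_le hB hT hρ ha hb (M := N ^ 2) (by positivity) l.1.2.le l.2.2.le
      k.1.2.le k.2.2.le).trans_eq ?_
    push_cast
    congr 1
    ring
  obtain ⟨ξ, h0, h1, h2⟩ := hC (N ^ 4) _ A hA0 (by positivity) (by simp; ring) (by simp; ring) hAb
  refine ⟨ξ, h0, fun s hs t ht => ?_, fun l => (h2 l).trans ?_⟩
  · have h3 := congrArg (algebraMap (𝓞 K) K) (congrFun h1 (⟨s, hs⟩, ⟨t, ht⟩))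
    have h4 : ∑ l, (T : K) ^ (2 * N ^ 3 + 2 * (N ^ 2 * N)) *
        ((s + t * ρ) ^ (l.1 : ℕ) * (a ^ s * b ^ t) ^ (l.2 : ℕ)) * (ξ l : K) = 0 := by
      rw [Matrix.mulVec, dotProduct, map_sum, Pi.zero_apply, map_zero] at h3
      simp only [map_mul] at h3
      exact h3
    refine (mul_eq_zero_iff_left (pow_ne_zero (2 * N ^ 3 + 2 * (N ^ 2 * N))
      (Int.cast_ne_zero.mpr hT0 : (T : K) ≠ 0))).mp ?_
    rw [← h4, Finset.mul_sum]
    exact Finset.sum_congr rfl fun l _ => by ring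
  · push_cast
    gcongr

/-- Liouville-type lower bound for the nonzero values of the auxiliary function. -/
lemma one_le_pow_mul_norm_value (φ : K →+* ℂ) {T : ℤ} {ρ a b : K} {B : ℝ} (hB : 1 ≤ B)
    (hT0 : T ≠ 0) (hρi : IsIntegral ℤ ((T : K) * ρ)) (hai : IsIntegral ℤ ((T : K) * a))
    (hbi : IsIntegral ℤ ((T : K) * b)) (hT : house (T : K) ≤ B)
    (hρ : house ρ ≤ B) (ha : house a ≤ B) (hb : house b ≤ B) {N M : ℕ} (hN : 0 < N)
    (hM : N ^ 2 ≤ M) {ξ : Fin (2 * N ^ 3) × Fin N → 𝓞 K}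
    (hξ : ∀ l, house (ξ l : K) ≤ (2 * B * M) ^ (10 * (N * M))) {s t : ℕ} (hs : s ≤ M)
    (ht : t ≤ M)
    (h0 : ∑ l, (ξ l : K) * ((s + t * ρ) ^ (l.1 : ℕ) * (a ^ s * b ^ t) ^ (l.2 : ℕ)) ≠ 0) :
    1 ≤ (2 * B * M) ^ (4 * (N * M) + 20 * (N * M) * (Module.finrank ℚ K - 1)) *
      ‖φ (∑ l, (ξ l : K) * ((s + t * ρ) ^ (l.1 : ℕ) * (a ^ s * b ^ t) ^ (l.2 : ℕ)))‖ := by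
  obtain ⟨h1, h2, h3, h4⟩ := level_bounds hB hN hM
  set V := ∑ l, (ξ l : K) * ((s + t * ρ) ^ (l.1 : ℕ) * (a ^ s * b ^ t) ^ (l.2 : ℕ)) with hV
  set k := 2 * N ^ 3 + 2 * (M * N) with hk
  have hk4 : k ≤ 4 * (N * M) := by rw [hk, mul_comm M N]; omega
  have hE : (T : K) ^ k * V = ∑ l, (ξ l : K) * ((T : K) ^ k *
      ((s + t * ρ) ^ (l.1 : ℕ) * (a ^ s * b ^ t) ^ (l.2 : ℕ))) := by
    rw [hV, Finset.mul_sum]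
    exact Finset.sum_congr rfl fun l _ => by ring
  have hE0 : (T : K) ^ k * V ≠ 0 := mul_ne_zero (pow_ne_zero _ (Int.cast_ne_zero.mpr hT0)) h0
  have hEi : IsIntegral ℤ ((T : K) ^ k * V) := by
    rw [hE]
    exact IsIntegral.sum _ fun l _ => (ξ l).2.mul
      (isIntegral_scaled hρi hai hbi l.1.2.le l.2.2.le hs ht)
  have hEh : house ((T : K) ^ k * V) ≤ (2 * B * M) ^ (20 * (N * M)) := by
    rw [hE]
    refine (house_sum_le_sum_house _ _).trans ?_
    have hl : ∀ l ∈ (Finset.univ : Finset (Fin (2 * N ^ 3) × Fin N)), house ((ξ l : K) *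
        ((T : K) ^ k * ((s + t * ρ) ^ (l.1 : ℕ) * (a ^ s * b ^ t) ^ (l.2 : ℕ)))) ≤
        (2 * B * M) ^ (10 * (N * M)) * (2 * B * M) ^ (8 * (N * M)) := by
      intro l _
      refine (house_mul_le _ _).trans ?_
      gcongr
      · exact house_nonneg _
      · exact hξ l
      · refine (house_scaled_le hB hT hρ ha hb h2 l.1.2.le l.2.2.le hs ht).trans
          (pow_le_pow_right₀ h1 ?_)
        rw [mul_comm M N]; omega
    refine (Finset.sum_le_sum hl).trans ?_
    rw [Finset.sum_const, Finset.card_univ, Fintype.card_prod, Fintype.card_fin,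
      Fintype.card_fin, nsmul_eq_mul, Nat.cast_mul]
    calc _ ≤ (2 * B * M : ℝ) ^ (2 * (N * M)) *
          ((2 * B * M) ^ (10 * (N * M)) * (2 * B * M : ℝ) ^ (8 * (N * M))) := by
          gcongr
          exact card_le_level hB hN hM
      _ = (2 * B * M) ^ (20 * (N * M)) := by ring
  have hTφ : ‖φ T‖ ≤ 2 * B * M := by
    have : (1 : ℝ) ≤ M := by exact_mod_cast h2
    exact ((norm_embedding_le_house _ φ).trans hT).trans (by nlinarith)
  refine (one_le_norm_mul_house_pow φ hEi hE0).trans ?_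
  rw [map_mul, map_pow, norm_mul, norm_pow]
  calc _ ≤ (2 * B * M : ℝ) ^ (4 * (N * M)) * ‖φ V‖ *
        ((2 * B * M) ^ (20 * (N * M))) ^ (Module.finrank ℚ K - 1) := by
        have := house_nonneg ((T : K) ^ k * V)
        gcongr
        · exact (pow_le_pow_left₀ (norm_nonneg _) hTφ _).trans (pow_le_pow_right₀ h1 hk4)
    _ = _ := by rw [← pow_mul, pow_add]; ring

open Classical in
/-- If `exp α` and `exp (α * ρ)` lie in a number field containing the irrational number `ρ`, then
`α = 0`. The proof is Schneider's: the auxiliary exponential polynomial vanishes on ever larger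
boxes of points `s + t * ρ`, hence identically. -/
lemma false_of_exp_eq (φ : K →+* ℂ) {ρ a b : K} {α : ℂ} (hα : α ≠ 0)
    (ha : Complex.exp α = φ a) (hb : Complex.exp (α * φ ρ) = φ b)
    (hρ : ∀ q : ℚ, (q : ℂ) ≠ φ ρ) : False := by
  obtain ⟨T, hT0, hT⟩ := exists_integral_multiples ℤ ℚ (L := K) ({ρ, a, b} : Finset K)
  simp only [Finset.mem_insert, Finset.mem_singleton, forall_eq_or_imp, forall_eq,
    zsmul_eq_mul] at hT
  obtain ⟨hρi, hai, hbi⟩ := hT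
  obtain ⟨C, hC⟩ := exists_siegel_const K
  set β : ℝ := 1 + ‖φ ρ‖ with hβ
  have hβ1 : 1 ≤ β := by simp [hβ]
  obtain ⟨B, hB⟩ := exists_nat_ge (1 + |C| + house (T : K) + house ρ + house a + house b + 5 * β +
    Real.exp (‖α‖ * (5 * β)))
  have := house_nonneg (T : K)
  have := house_nonneg ρ
  have := house_nonneg a
  have := house_nonneg b
  have := Real.exp_pos (‖α‖ * (5 * β))
  have := abs_nonneg C
  have hB1 : (1 : ℝ) ≤ B := by linarith
  have hBβ : 5 * β ≤ B := by linarith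
  have hBe : Real.exp (‖α‖ * (5 * β)) ≤ B := by linarith
  have hBT : house (T : K) ≤ B := by linarith
  have hBρ : house ρ ≤ B := by linarith
  have hBa : house a ≤ B := by linarith
  have hBb : house b ≤ B := by linarith
  set d := Module.finrank ℚ K with hd
  have hd0 : 0 < d := Module.finrank_pos
  obtain ⟨N, hN, hgrow⟩ := exists_mul_pow_le_two_pow_sq (4 * B) (24 * d)
  obtain ⟨ξ, hξ0, hξ, hξB⟩ := exists_auxiliary_coeffs hB1 hC ((le_abs_self C).trans (by linarith))
    hT0 hρi hai hbi hBT hBρ hBa hBb hN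
  set F := expPoly (fun l => φ (ξ l : K)) α with hF
  have hval := expPoly_add_mul_eq φ (fun l => (ξ l : K)) ha hb
  have hξM : ∀ M : ℕ, N ^ 2 ≤ M → ∀ l, house (ξ l : K) ≤ (2 * B * M) ^ (10 * (N * M)) :=
    fun M hM l => (hξB l).trans (coeff_bound_le_level hB1 hN hM)
  have hpt : ∀ s t M : ℕ, s ≤ M → t ≤ M → ‖(s : ℂ) + t * φ ρ‖ ≤ β * M := by
    intro s t M hs ht
    have hs' : (s : ℝ) ≤ M := by exact_mod_cast hs
    have ht' : (t : ℝ) ≤ M := by exact_mod_cast ht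
    refine (norm_add_le _ _).trans ?_
    rw [norm_mul, Complex.norm_natCast, Complex.norm_natCast]
    nlinarith [norm_nonneg (φ ρ)]
  have hsmall : ∀ M : ℕ, N ^ 2 ≤ M → (∀ s < M, ∀ t < M, F (s + t * φ ρ) = 0) →
      ∀ w, ‖w‖ ≤ β * M → ‖F w‖ ≤ (2 * B * M) ^ (20 * (N * M)) / 2 ^ M ^ 2 := by
    intro M hM hz w hw
    obtain ⟨h1, h2, h3, h4⟩ := level_bounds hB1 hN hM
    have hM1 : (1 : ℝ) ≤ M := by exact_mod_cast h2
    rw [← card_image_add_mul hρ M]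
    refine norm_le_div_two_pow_of_zeros (differentiable_expPoly _ _) (r := β * M) (by positivity)
      ?_ ?_ (fun z hz => norm_expPoly_le_level hB1 hN hM
        (fun l => (norm_embedding_le_house _ φ).trans (hξM M hM l)) hβ1 hBβ hBe hz) hw
    · simp only [Finset.mem_image, Finset.mem_product, Finset.mem_range]
      rintro _ ⟨⟨s, t⟩, ⟨hs, ht⟩, rfl⟩
      exact hz s hs t ht
    · simp only [Finset.mem_image, Finset.mem_product, Finset.mem_range]
      rintro _ ⟨⟨s, t⟩, ⟨hs, ht⟩, rfl⟩
      exact hpt s t M hs.le ht.le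
  have hdecay : ∀ M : ℕ, N ^ 2 ≤ M →
      (2 * B * M : ℝ) ^ (24 * d * (N * M)) / 2 ^ M ^ 2 ≤ 1 / 2 ^ M := by
    intro M hM
    obtain ⟨h1, h2, h3, h4⟩ := level_bounds hB1 hN hM
    rw [div_le_div_iff₀ (by positivity) (by positivity), one_mul]
    calc (2 * B * M : ℝ) ^ (24 * d * (N * M)) * 2 ^ M
        ≤ (2 * B * M : ℝ) ^ (24 * d * (N * M)) * 2 ^ (24 * d * (N * M)) := by
          gcongr
          · norm_num
          · nlinarith [Nat.mul_le_mul (show 1 ≤ 24 * d by omega) (Nat.le_mul_of_pos_left M hN)]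
      _ = (4 * B * M) ^ (24 * d * N * M) := by rw [← mul_pow]; ring
      _ ≤ 2 ^ M ^ 2 := by exact_mod_cast hgrow M hM
  have hzero : ∀ M : ℕ, N ^ 2 ≤ M → ∀ s < M, ∀ t < M, F (s + t * φ ρ) = 0 := by
    intro M hM
    induction M, hM using Nat.le_induction with
    | base =>
      intro s hs t ht
      rw [hF, hval, hξ s hs t ht, map_zero]
    | succ M hM ih =>
      intro s hs t ht
      replace hs := Nat.le_of_lt_succ hs
      replace ht := Nat.le_of_lt_succ ht
      obtain ⟨h1, h2, h3, h4⟩ := level_bounds hB1 hN hM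
      by_contra hne
      have hne' := hne
      rw [hF, hval] at hne'
      have hlt : (1 : ℝ) / 2 ^ M < 1 := by
        rw [div_lt_one (by positivity)]
        exact one_lt_pow₀ one_lt_two h2.ne'
      refine absurd (one_le_pow_mul_norm_value φ hB1 hT0 hρi hai hbi hBT hBρ hBa hBb hN hM
        (hξM M hM) hs ht fun h => hne' (by rw [h, map_zero])) (not_le.mpr (lt_of_le_of_lt ?_ hlt))
      rw [← hval]
      refine le_trans ?_ (hdecay M hM)
      have he : 4 * (N * M) + 20 * (N * M) * (d - 1) + 20 * (N * M) ≤ 24 * d * (N * M) := by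
        obtain ⟨e, he⟩ := Nat.exists_eq_succ_of_ne_zero hd0.ne'
        rw [he, Nat.succ_sub_one, Nat.succ_eq_add_one]
        nlinarith
      calc _ ≤ (2 * B * M : ℝ) ^ (4 * (N * M) + 20 * (N * M) * (d - 1)) *
            ((2 * B * M) ^ (20 * (N * M)) / 2 ^ M ^ 2) := by
            gcongr
            exact hsmall M hM ih _ (hpt s t M hs ht)
        _ = (2 * B * M : ℝ) ^ (4 * (N * M) + 20 * (N * M) * (d - 1) + 20 * (N * M)) /
            2 ^ M ^ 2 := by rw [mul_div_assoc', ← pow_add]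
        _ ≤ _ := by gcongr
  have hF0 : ∀ w, F w = 0 := by
    intro w
    have ht : Filter.Tendsto (fun M : ℕ => (1 : ℝ) / 2 ^ M) Filter.atTop (nhds 0) := by
      simpa using tendsto_pow_atTop_nhds_zero_of_lt_one (r := (1 / 2 : ℝ)) (by norm_num)
        (by norm_num)
    refine norm_le_zero_iff.mp (ge_of_tendsto ht ?_)
    filter_upwards [Filter.eventually_ge_atTop (N ^ 2),
      Filter.eventually_ge_atTop ⌈‖w‖⌉₊] with M hM hw
    obtain ⟨h1, h2, h3, h4⟩ := level_bounds hB1 hN hM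
    have hw' : ‖w‖ ≤ M := Nat.ceil_le.mp hw
    refine (hsmall M hM (hzero M hM) w (by nlinarith)).trans (le_trans ?_ (hdecay M hM))
    gcongr
    · omega
  refine hξ0 (funext fun l => ?_)
  have := congrFun (eq_zero_of_expPoly_eq_zero hα hF0) l
  simpa using this

/-- **The Gelfond–Schneider theorem.** If `a` and `ρ` are algebraic, `a ≠ 0`, `a ≠ 1`,
`ρ` is irrational, and `exp α = a`, then `exp (ρ * α)` (a value of `a^ρ`) is
transcendental. -/
theorem gelfond_schneider (a ρ α : ℂ)
    (ha : IsAlgebraic ℚ a) (hρ : IsAlgebraic ℚ ρ)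
    (ha0 : a ≠ 0) (ha1 : a ≠ 1) (hirr : ∀ q : ℚ, (q : ℂ) ≠ ρ)
    (hα : Complex.exp α = a) :
    Transcendental ℚ (Complex.exp (ρ * α)) := by
  intro hb
  set b := Complex.exp (ρ * α)
  let L := IntermediateField.adjoin ℚ ({a, ρ, b} : Set ℂ)
  have : FiniteDimensional ℚ L := IntermediateField.finiteDimensional_adjoin (by
    rintro x (rfl | rfl | rfl)
    exacts [ha.isIntegral, hρ.isIntegral, hb.isIntegral])
  have : NumberField L := ⟨⟩
  have hmem : ∀ x ∈ ({a, ρ, b} : Set ℂ), x ∈ L := fun x hx =>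
    IntermediateField.subset_adjoin ℚ _ hx
  refine false_of_exp_eq (K := L) (algebraMap L ℂ) (ρ := ⟨ρ, hmem ρ (by simp)⟩)
    (a := ⟨a, hmem a (by simp)⟩) (b := ⟨b, hmem b (by simp)⟩) (α := α) ?_ hα ?_ hirr
  · rintro rfl
    exact ha1 (by rw [← hα, Complex.exp_zero])
  · change Complex.exp (α * ρ) = b
    rw [mul_comm]
end

section
/- (Lindemann–Weierstrass theorem). If a₁,…,aₙ are algebraic complex numbers that are linearly independent over ℚ, then exp(a₁),…,exp(aₙ) are algebraically independent over ℚ. -/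
open Polynomial Finset AddMonoidAlgebra
open scoped Nat

theorem isIntegral_pow_mul_aeval {R A : Type*} [CommRing R] [CommRing A] [Algebra R A]
    {d : R} {x : A} (hx : IsIntegral R (d • x)) (p : R[X]) {m : ℕ} (hm : p.natDegree ≤ m) :
    IsIntegral R (d ^ m • aeval x p) := by
  rw [aeval_eq_sum_range' (Nat.lt_succ_of_le hm), Finset.smul_sum]
  refine IsIntegral.sum _ fun i hi => ?_
  have hi' : i ≤ m := Nat.lt_succ_iff.1 (Finset.mem_range.1 hi)
  have : d ^ m • p.coeff i • x ^ i = (d ^ (m - i) * p.coeff i) • (d • x) ^ i := by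
    rw [_root_.smul_pow, smul_smul, smul_smul, ← pow_sub_mul_pow d hi']
    ring_nf
  rw [this]
  exact (hx.pow i).smul _

theorem exists_int_polynomial_aeval_eq_zero {K : Type*} [Field K] [Algebra ℚ K] [FiniteDimensional ℚ K] (S : Finset K)
    (hS : (0 : K) ∉ S) : ∃ f : ℤ[X], f.eval 0 ≠ 0 ∧ ∀ k ∈ S, aeval k f = 0 := by
  have h : ∀ k ∈ S, ∃ q : ℤ[X], q.coeff 0 ≠ 0 ∧ aeval k q = 0 := fun k hk =>
    ((IsFractionRing.isAlgebraic_iff ℤ ℚ K).2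
      (Algebra.IsAlgebraic.isAlgebraic k)).exists_nonzero_coeff_and_aeval_eq_zero
        (mem_nonZeroDivisors_of_ne_zero (ne_of_mem_of_not_mem hk hS))
  choose! q hq0 hq using h
  refine ⟨∏ k ∈ S, q k, ?_, fun k hk => ?_⟩
  · rw [eval_prod, Finset.prod_ne_zero_iff]
    intro k hk
    rw [← coeff_zero_eq_eval_zero]
    exact hq0 k hk
  · rw [map_prod]
    exact Finset.prod_eq_zero hk (hq k hk)

theorem exists_prime_gt_mul_pow_div_factorial_lt_one (B C : ℝ) (M : ℕ) :
    ∃ p : ℕ, p.Prime ∧ M < p ∧ B * C ^ p / (p - 1)! < 1 := by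
  have h := (FloorSemiring.tendsto_mul_pow_div_factorial_sub_atTop B C 1).eventually_lt_const
    zero_lt_one
  obtain ⟨m, hm⟩ := Filter.eventually_atTop.1 h
  obtain ⟨p, hp, hprime⟩ := Nat.exists_infinite_primes (max m (M + 1))
  exact ⟨p, hprime, by omega, hm p (by omega)⟩

/-- The evaluation of a formal combination of elements of `K` at their complex exponentials. -/
noncomputable def expEval (K : Type*) [Field K] [Algebra K ℂ] : AddMonoidAlgebra ℤ K →ₐ[ℤ] ℂ :=
  AddMonoidAlgebra.lift ℤ ℂ K
    (Complex.expMonoidHom.comp (algebraMap K ℂ).toAddMonoidHom.toMultiplicative)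

theorem expEval_single {K : Type*} [Field K] [Algebra K ℂ] (k : K) (n : ℤ) :
    expEval K (single k n) = n • Complex.exp (algebraMap K ℂ k) := by
  simp [expEval]

open Classical in
theorem sum_smul_aeval_fixed {K : Type*} [Field K] [Algebra ℚ K] (c : K →₀ ℤ)
    (hc : ∀ (σ : Gal(K/ℚ)) k, c (σ k) = c k) (g : ℤ[X]) (σ : Gal(K/ℚ)) :
    σ (∑ k ∈ c.support.erase 0, c k • aeval k g) = ∑ k ∈ c.support.erase 0, c k • aeval k g := by
  rw [map_sum]
  refine Finset.sum_equiv σ.toEquiv (fun k => ?_) fun k _ => ?_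
  · simp [hc]
  · have : σ (aeval k g) = aeval (σ k) g := by
      simpa using (aeval_algHom_apply ((σ : K →ₐ[ℚ] K).restrictScalars ℤ) k g).symm
    simp [hc, this]

section Galois

variable {K : Type*} [Field K] [Algebra ℚ K] [FiniteDimensional ℚ K] [IsGalois ℚ K]

theorem exists_int_eq_of_isIntegral_of_fixed {x : K} (hx : IsIntegral ℤ x)
    (hfix : ∀ σ : Gal(K/ℚ), σ x = x) : ∃ N : ℤ, (N : K) = x := by
  obtain ⟨r, rfl⟩ := (IsGalois.mem_range_algebraMap_iff_fixed x).2 hfix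
  rw [isIntegral_algebraMap_iff (algebraMap ℚ K).injective] at hx
  obtain ⟨N, rfl⟩ := IsIntegrallyClosed.isIntegral_iff.1 hx
  exact ⟨N, by simp⟩

variable [Algebra K ℂ]

theorem sum_mul_exp_ne_zero_of_fixed (c : K →₀ ℤ) (hc : ∀ (σ : Gal(K/ℚ)) k, c (σ k) = c k)
    (h0 : c 0 ≠ 0) : c.sum (fun k n => n • Complex.exp (algebraMap K ℂ k)) ≠ 0 := by
  classical
  intro hsum
  set S := c.support.erase 0 with hS
  have hsplit : (c 0 : ℂ) = -∑ k ∈ S, c k • Complex.exp (algebraMap K ℂ k) := by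
    rw [Finsupp.sum, ← Finset.add_sum_erase _ _ (Finsupp.mem_support_iff.2 h0)] at hsum
    simpa using eq_neg_of_add_eq_zero_left hsum
  obtain ⟨f, hf0, hf⟩ := exists_int_polynomial_aeval_eq_zero S (by simp [hS])
  obtain ⟨D, hD0, hD⟩ := exists_integral_multiples ℤ ℚ S
  obtain ⟨C, hC⟩ := LindemannWeierstrass.exp_polynomial_approx f hf0
  obtain ⟨p, hp, hpM, hlt⟩ := exists_prime_gt_mul_pow_div_factorial_lt_one
    (∑ k ∈ S, ‖(c k : ℂ)‖) (‖(D : ℂ)‖ ^ f.natDegree * C)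
    ((f.eval 0).natAbs + D.natAbs + (c 0).natAbs)
  obtain ⟨n, hn, g, hg, happrox⟩ := hC p (by omega) hp
  set m := p * f.natDegree with hm
  obtain ⟨N, hN⟩ := exists_int_eq_of_isIntegral_of_fixed
    (x := D ^ m • ∑ k ∈ S, c k • aeval k g)
    (by
      rw [Finset.smul_sum]
      refine IsIntegral.sum _ fun k hk => ?_
      rw [smul_comm]
      exact (isIntegral_pow_mul_aeval (hD k hk) g (by omega)).smul _)
    (fun σ => by rw [map_zsmul, sum_smul_aeval_fixed c hc])
  have hNC : (N : ℂ) = D ^ m * ∑ k ∈ S, c k * aeval (algebraMap K ℂ k) g := by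
    have := congrArg (algebraMap K ℂ) hN
    simpa [aeval_algebraMap_apply] using this
  have hz : D ^ m * n * c 0 + p * N ≠ 0 := by
    intro h
    have hpz : Prime (p : ℤ) := Nat.prime_iff_prime_int.1 hp
    have hdvd : (p : ℤ) ∣ D ^ m * n * c 0 :=
      (Int.dvd_add_left (Dvd.intro _ rfl)).1 (h ▸ dvd_zero _)
    have hsmall : ∀ z : ℤ, z ≠ 0 → z.natAbs < p → ¬ (p : ℤ) ∣ z := fun z hz hlt hd =>
      (Nat.le_of_dvd (Int.natAbs_pos.2 hz) (Int.natCast_dvd.1 hd)).not_gt hlt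
    rcases hpz.dvd_or_dvd hdvd with h | h
    · rcases hpz.dvd_or_dvd h with h | h
      · exact hsmall D hD0 (by omega) (hpz.dvd_of_dvd_pow h)
      · exact hn h
    · exact hsmall _ h0 (by omega) h
  have hcast : ((D ^ m * n * c 0 + p * N : ℤ) : ℂ) = -(D ^ m * ∑ k ∈ S, c k *
      (n • Complex.exp (algebraMap K ℂ k) - p • aeval (algebraMap K ℂ k) g)) := by
    push_cast
    rw [hNC, hsplit]
    simp only [zsmul_eq_mul, nsmul_eq_mul, mul_sub, Finset.sum_sub_distrib, mul_left_comm _ (n : ℂ),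
      mul_left_comm _ (p : ℂ), ← Finset.mul_sum]
    ring
  have hle : ‖((D ^ m * n * c 0 + p * N : ℤ) : ℂ)‖ ≤
      (∑ k ∈ S, ‖(c k : ℂ)‖) * (‖(D : ℂ)‖ ^ f.natDegree * C) ^ p / (p - 1)! := by
    rw [hcast, norm_neg, norm_mul, norm_pow]
    have hbound : ‖∑ k ∈ S, c k *
        (n • Complex.exp (algebraMap K ℂ k) - p • aeval (algebraMap K ℂ k) g)‖ ≤
        ∑ k ∈ S, ‖(c k : ℂ)‖ * (C ^ p / (p - 1)!) := by
      refine norm_sum_le_of_le _ fun k hk => ?_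
      rw [norm_mul]
      gcongr
      refine happrox ?_
      rw [mem_aroots]
      refine ⟨?_, by rw [aeval_algebraMap_apply, hf k hk, map_zero]⟩
      rintro rfl
      simp at hf0
    grw [hbound]
    rw [← Finset.sum_mul, mul_pow, ← pow_mul, mul_comm f.natDegree]
    apply le_of_eq
    ring
  have hone : (1 : ℝ) ≤ ‖((D ^ m * n * c 0 + p * N : ℤ) : ℂ)‖ := by
    rw [Complex.norm_intCast]
    exact_mod_cast Int.one_le_abs hz
  linarith

theorem expEval_ne_zero_of_fixed {x : AddMonoidAlgebra ℤ K}
    (hx : ∀ σ : Gal(K/ℚ), domCongr ℤ ℤ (σ : K ≃+ K) x = x) {k : K} (hk : x.coeff k ≠ 0) :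
    expEval K x ≠ 0 := by
  have hcoeff : ∀ (y : AddMonoidAlgebra ℤ K), (∀ σ : Gal(K/ℚ), domCongr ℤ ℤ (σ : K ≃+ K) y = y) →
      ∀ (σ : Gal(K/ℚ)) j, y.coeff (σ j) = y.coeff j := fun y hy σ j => by
    conv_lhs => rw [← hy σ]
    simp [coeff_domCongr]
  set s : AddMonoidAlgebra ℤ K := ∑ σ : Gal(K/ℚ), single (-σ k) 1 with hs
  have hs_fixed : ∀ τ : Gal(K/ℚ), domCongr ℤ ℤ (τ : K ≃+ K) s = s := fun τ => by
    rw [hs, map_sum]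
    exact Fintype.sum_equiv (Equiv.mulLeft τ) _ _ fun σ => by simp; rfl
  have h0 : (x * s).coeff 0 ≠ 0 := by
    simp [hs, Finset.mul_sum, hcoeff x hx, hk]
  have := sum_mul_exp_ne_zero_of_fixed (x * s).coeff
    (hcoeff _ fun σ => by rw [map_mul, hx, hs_fixed]) h0
  have hE : expEval K (x * s) ≠ 0 := by
    rwa [expEval, AddMonoidAlgebra.lift_apply]
  rw [map_mul] at hE
  exact left_ne_zero_of_mul hE

theorem expEval_injective : Function.Injective (expEval K) := by
  rw [injective_iff_map_eq_zero]
  intro x hx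
  by_contra hx0
  set y := ∏ σ : Gal(K/ℚ), domCongr ℤ ℤ (σ : K ≃+ K) x with hy
  have hy0 : y ≠ 0 := Finset.prod_ne_zero_iff.2 fun σ _ => by simpa using hx0
  have hy_fixed : ∀ τ : Gal(K/ℚ), domCongr ℤ ℤ (τ : K ≃+ K) y = y := fun τ => by
    rw [hy, map_prod]
    refine Fintype.prod_equiv (Equiv.mulLeft τ) _ _ fun σ => ?_
    ext
    simp [coeff_domCongr]
    rfl
  obtain ⟨k, hk⟩ := Finsupp.ne_iff.1 (coeff_eq_zero.not.2 hy0)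
  refine expEval_ne_zero_of_fixed hy_fixed hk ?_
  rw [hy, map_prod]
  refine Finset.prod_eq_zero (Finset.mem_univ 1) ?_
  convert hx
  ext
  simp [coeff_domCongr]
  rfl

theorem algebraicIndependent_exp_algebraMap {ι : Type*} {a : ι → K}
    (ha : LinearIndependent ℚ a) :
    AlgebraicIndependent ℚ fun i => Complex.exp (algebraMap K ℂ (a i)) := by
  suffices h : AlgebraicIndependent ℤ fun i => Complex.exp (algebraMap K ℂ (a i)) from
    have : Algebra.IsAlgebraic ℤ ℚ := IsLocalization.isAlgebraic ℚ (nonZeroDivisors ℤ)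
    h.extendScalars ℚ
  let ψ : MvPolynomial ι ℤ →ₐ[ℤ] AddMonoidAlgebra ℤ K :=
    mapDomainAlgHom ℤ ℤ (Finsupp.linearCombination ℕ a).toAddMonoidHom
  have hψ : Function.Injective ψ :=
    mapDomain_injective (ha.restrict_scalars' ℕ)
  rw [algebraicIndependent_iff_injective_aeval]
  have : MvPolynomial.aeval (fun i => Complex.exp (algebraMap K ℂ (a i))) = (expEval K).comp ψ := by
    refine MvPolynomial.algHom_ext fun i => ?_
    have : ψ (MvPolynomial.X i) = single (a i) 1 := by
      simp [ψ, MvPolynomial.X, MvPolynomial.monomial]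
    simp [this, expEval_single]
  rw [this]
  exact expEval_injective.comp hψ

end Galois

theorem exists_finiteDimensional_isGalois_intermediateField {ι F E : Type*} [Finite ι] [Field F] [CharZero F]
    [Field E] [Algebra F E] [IsAlgClosed E] {a : ι → E} (ha : ∀ i, IsAlgebraic F (a i)) :
    ∃ K : IntermediateField F E, FiniteDimensional F K ∧ IsGalois F K ∧ ∀ i, a i ∈ K := by
  set L := IntermediateField.adjoin F (Set.range a)
  have : FiniteDimensional F L := IntermediateField.finiteDimensional_adjoin (by
    rintro _ ⟨i, rfl⟩
    exact (ha i).isIntegral)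
  have : IsNormalClosure F L (IntermediateField.normalClosure F L E) :=
    Algebra.IsAlgebraic.isNormalClosure_normalClosure fun x => IsAlgClosed.splits _
  have : Normal F (IntermediateField.normalClosure F L E) := IsNormalClosure.normal (K := L)
  exact ⟨IntermediateField.normalClosure F L E, inferInstance, ⟨⟩,
    fun i => L.le_normalClosure (IntermediateField.subset_adjoin F _ ⟨i, rfl⟩)⟩

/-- **The Lindemann–Weierstrass theorem.** If `a₁,…,aₙ` are algebraic complex numbers
that are linearly independent over `ℚ`, then `exp a₁,…,exp aₙ` are algebraically
independent over `ℚ`. -/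
theorem lindemann_weierstrass (n : ℕ) (a : Fin n → ℂ)
    (halg : ∀ i, IsAlgebraic ℚ (a i)) (hli : LinearIndependent ℚ a) :
    AlgebraicIndependent ℚ fun i => Complex.exp (a i) := by
  obtain ⟨K, hfin, hgal, hmem⟩ := exists_finiteDimensional_isGalois_intermediateField halg
  let _ : Algebra ℚ K := K.algebra'
  have hb : LinearIndependent ℚ (fun i => (⟨a i, hmem i⟩ : K)) :=
    LinearIndependent.of_comp (IntermediateField.val K).toLinearMap hli
  simpa only [IntermediateField.algebraMap_apply] using algebraicIndependent_exp_algebraMap hb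
end
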